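/- Let Γ be a labelled graph with vertex set V and let T ⊆ V be the set of cone points of Γ. If the induced labelled subgraph Γ_T satisfies the Center Conjecture, then Γ satisfies the Center Conjecture. -/

import Mathlib

/-- A labelled graph: a vertex set `V` and a symmetric labelling `m : V → V → ℕ∞`
with `m u v ≥ 2` for `u ≠ v` (`m u v = ∞` means no edge). -/
structure LabelledGraph (V : Type*) where
  m : V → V → ℕ∞
  symm : ∀ u v, m u v = m v u
  two_le : ∀ u v, u ≠ v → 2 ≤ m u v

namespace LabelledGraph

variable {V W : Type*}

/-- The alternating product `x * y * x * ⋯` with `n` terms. -/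
def altProd {G : Type*} [Monoid G] (x y : G) : ℕ → G
  | 0 => 1
  | n + 1 => x * altProd y x n

/-- The alternating word `u v u v ⋯` with `n` terms in the free group. -/
def altWord (u v : V) (n : ℕ) : FreeGroup V :=
  altProd (FreeGroup.of u) (FreeGroup.of v) n

/-- The Artin relations of a labelled graph: for each `u ≠ v` with finite label
`m u v = k`, the relation `(u v u ⋯) = (v u v ⋯)` (both sides with `k` terms). -/
def artinRels (Γ : LabelledGraph V) : Set (FreeGroup V) :=
  { r | ∃ (u v : V) (k : ℕ), u ≠ v ∧ Γ.m u v = (k : ℕ∞) ∧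
        r = altWord u v k * (altWord v u k)⁻¹ }

/-- The Artin group of a labelled graph. -/
abbrev ArtinGroup (Γ : LabelledGraph V) : Type _ := PresentedGroup Γ.artinRels

/-- The standard generators of an Artin group. -/
def σ (Γ : LabelledGraph V) (v : V) : Γ.ArtinGroup := PresentedGroup.of v

/-- The special subgroup of the Artin group generated by `{σ v : v ∈ K}`. -/
def specialSubgroup (Γ : LabelledGraph V) (K : Set V) : Subgroup Γ.ArtinGroup :=
  Subgroup.closure (Γ.σ '' K)

/-- A cone point of `Γ`: a vertex `t` with `m t v < ∞` for every `v ≠ t`. -/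
def IsConePoint (Γ : LabelledGraph V) (t : V) : Prop :=
  ∀ v : V, v ≠ t → Γ.m t v ≠ ⊤

/-- The induced labelled subgraph on a subset `K` of the vertices. -/
def induce (Γ : LabelledGraph V) (K : Set V) : LabelledGraph K where
  m u v := Γ.m u v
  symm u v := Γ.symm u v
  two_le u v h := Γ.two_le u v (fun e => h (Subtype.ext e))

/-- `Γ` is irreducible if its vertex set admits no partition into two nonempty sets
with all labels between the two parts equal to `2`. -/
def Irreducible (Γ : LabelledGraph V) : Prop :=
  ¬ ∃ V₁ V₂ : Set V, V₁.Nonempty ∧ V₂.Nonempty ∧ Disjoint V₁ V₂ ∧ V₁ ∪ V₂ = Set.univ ∧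
      ∀ u ∈ V₁, ∀ v ∈ V₂, Γ.m u v = 2

/-- The square relations `σ_v² = 1` defining the Coxeter quotient. -/
def squareRels (V : Type*) : Set (FreeGroup V) :=
  Set.range fun v : V => FreeGroup.of v * FreeGroup.of v

/-- The Coxeter group of a labelled graph: the quotient of the Artin group obtained
by adding the relations `σ_v² = 1`. -/
abbrev CoxeterGroupOf (Γ : LabelledGraph V) : Type _ :=
  PresentedGroup (Γ.artinRels ∪ squareRels V)

/-- `Γ` is spherical if its Coxeter group is finite. -/
def Spherical (Γ : LabelledGraph V) : Prop := Finite Γ.CoxeterGroupOf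

/-- The natural surjection `θ` from the Artin group to the Coxeter group. -/
def artinToCoxeter (Γ : LabelledGraph V) : Γ.ArtinGroup →* Γ.CoxeterGroupOf :=
  QuotientGroup.map _ _ (MonoidHom.id _)
    (by
      intro x hx
      simpa using Subgroup.normalClosure_mono (Set.subset_union_left (t := squareRels V)) hx)

/-- The pure Artin group: the kernel of the natural surjection to the Coxeter group. -/
def pureArtinGroup (Γ : LabelledGraph V) : Subgroup Γ.ArtinGroup :=
  (artinToCoxeter Γ).ker

/-- `P : Fin n → Set V` is a decomposition of `Γ` as a `2`-labelled join of
irreducible induced subgraphs. -/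
def IsIrredDecomp (Γ : LabelledGraph V) (n : ℕ) (P : Fin n → Set V) : Prop :=
  (∀ i, (P i).Nonempty) ∧
  (⋃ i, P i) = Set.univ ∧
  (∀ i j, i ≠ j → Disjoint (P i) (P j)) ∧
  (∀ i j, i ≠ j → ∀ u ∈ P i, ∀ v ∈ P j, Γ.m u v = 2) ∧
  (∀ i, (Γ.induce (P i)).Irreducible)

/-- `Γ` satisfies the Center Conjecture if for the (finest) decomposition of `Γ` as a
`2`-labelled join of irreducible induced subgraphs `Γ₁, …, Γₙ`, the center of the Artin
group `A_Γ` is free abelian of rank the number of spherical factors `Γᵢ`. -/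
def SatisfiesCenterConjecture (Γ : LabelledGraph V) : Prop :=
  ∀ (n : ℕ) (P : Fin n → Set V), Γ.IsIrredDecomp n P →
    Nonempty ((Subgroup.center Γ.ArtinGroup) ≃*
      Multiplicative (Fin (Nat.card {i : Fin n // (Γ.induce (P i)).Spherical}) → ℤ))

/-- A monoid hom applied to an alternating product. -/
theorem map_altProd {G H : Type*} [Monoid G] [Monoid H] (φ : G →* H) (x y : G) (n : ℕ) :
    φ (altProd x y n) = altProd (φ x) (φ y) n := by
  induction n generalizing x y with
  | zero => simp [altProd]
  | succ n ih => simp [altProd, ih]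

/-- The homomorphism between Artin groups induced by a label-preserving injection of
labelled graphs, sending generators to generators. -/
def mapHom (Γ : LabelledGraph V) (Δ : LabelledGraph W) (f : V → W)
    (hf : ∀ u v : V, u ≠ v → f u ≠ f v)
    (hm : ∀ u v : V, Γ.m u v = Δ.m (f u) (f v)) :
    Γ.ArtinGroup →* Δ.ArtinGroup :=
  PresentedGroup.toGroup (f := fun v => Δ.σ (f v))
    (by
      rintro r ⟨u, v, k, huv, hk, rfl⟩
      have key : ∀ (a b : V),
          FreeGroup.lift (fun v => Δ.σ (f v)) (altWord a b k)
            = PresentedGroup.mk Δ.artinRels (altWord (f a) (f b) k) := by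
        intro a b
        rw [altWord, map_altProd, altWord, map_altProd]
        simp [σ, PresentedGroup.of]
      rw [map_mul, map_inv, key, key, ← map_inv, ← map_mul]
      refine (QuotientGroup.eq_one_iff _).mpr (Subgroup.subset_normalClosure ?_)
      exact ⟨f u, f v, k, hf u v huv, (hm u v) ▸ hk, rfl⟩)

@[simp]
theorem mapHom_σ (Γ : LabelledGraph V) (Δ : LabelledGraph W) (f : V → W)
    (hf : ∀ u v : V, u ≠ v → f u ≠ f v)
    (hm : ∀ u v : V, Γ.m u v = Δ.m (f u) (f v)) (v : V) :
    mapHom Γ Δ f hf hm (Γ.σ v) = Δ.σ (f v) :=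
  PresentedGroup.toGroup.of _

/-- The homomorphism between the Artin groups of induced subgraphs coming from an
inclusion `K' ⊆ K`. -/
def induceHom (Γ : LabelledGraph V) {K' K : Set V} (h : K' ⊆ K) :
    (Γ.induce K').ArtinGroup →* (Γ.induce K).ArtinGroup :=
  mapHom _ _ (Set.inclusion h)
    (fun _ _ huv e => huv (Set.inclusion_injective h e))
    (fun _ _ => rfl)

/-- The homomorphism from the Artin group of an induced subgraph to the ambient
Artin group. -/
def inclHom (Γ : LabelledGraph V) (K : Set V) :
    (Γ.induce K).ArtinGroup →* Γ.ArtinGroup :=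
  mapHom _ _ Subtype.val
    (fun _ _ huv e => huv (Subtype.ext e))
    (fun _ _ => rfl)

end LabelledGraph

namespace CoxeterSystem

variable {B W : Type*} [Group W] {M : CoxeterMatrix B} (cs : CoxeterSystem M W)

/-- The alternating list `u, v, u, …` with `n` entries, beginning with `u`. -/
def altList (u v : B) : ℕ → List B
  | 0 => []
  | n + 1 => u :: altList v u n

theorem mem_altList {u v b : B} {n : ℕ} (h : b ∈ altList u v n) : b = u ∨ b = v := by
  induction n generalizing u v with
  | zero => simp [altList] at h
  | succ n ih =>
    rcases List.mem_cons.mp h with h | h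
    · exact Or.inl h
    · exact (ih h).symm

theorem prod_map_altList {G : Type*} [Monoid G] (f : B → G) (u v : B) (n : ℕ) :
    ((altList u v n).map f).prod = LabelledGraph.altProd (f u) (f v) n := by
  induction n generalizing u v with
  | zero => rfl
  | succ n ih => simp [altList, LabelledGraph.altProd, ih]

theorem wordProd_altList (u v : B) (n : ℕ) :
    cs.wordProd (altList u v n) = LabelledGraph.altProd (cs.simple u) (cs.simple v) n :=
  prod_map_altList _ _ _ _

theorem prod_map_altList_two_mul {G : Type*} [Monoid G] (f : B → G) (u v : B) (n : ℕ) :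
    ((altList u v (2 * n)).map f).prod = (f u * f v) ^ n := by
  induction n with
  | zero => simp [altList]
  | succ n ih =>
    rw [Nat.mul_succ, pow_succ', ← ih]
    simp [altList, mul_assoc]

theorem mul_mul_pow_comm {G : Type*} [Monoid G] (x y : G) (n : ℕ) :
    x * (y * x) ^ n = (x * y) ^ n * x := by
  induction n with
  | zero => simp
  | succ n ih => rw [pow_succ, ← mul_assoc, ih, pow_succ]; simp [mul_assoc]

theorem _root_.LabelledGraph.altProd_mul_inv_altProd {G : Type*} [Group G] {x y : G}
    (hx : x * x = 1) (hy : y * y = 1) (n : ℕ) :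
    LabelledGraph.altProd x y n * (LabelledGraph.altProd y x n)⁻¹ = (x * y) ^ n := by
  induction n generalizing x y with
  | zero => simp [LabelledGraph.altProd]
  | succ n ih =>
    have hy' : y⁻¹ = y := inv_eq_of_mul_eq_one_left hy
    have : x * (LabelledGraph.altProd y x n * (LabelledGraph.altProd x y n)⁻¹) * y
        = (x * y) ^ (n + 1) := by
      rw [ih hy hx]
      rw [mul_mul_pow_comm, pow_succ, mul_assoc]
    rw [← this]
    simp [LabelledGraph.altProd, hy', mul_assoc]

theorem leftInvSeq_altList (u v : B) (n : ℕ) :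
    cs.leftInvSeq (altList u v n) =
      (List.range n).map fun k => (cs.simple u * cs.simple v) ^ k * cs.simple u := by
  induction n generalizing u v with
  | zero => rfl
  | succ n ih =>
    rw [altList, leftInvSeq, ih, List.range_succ_eq_map, List.map_cons, List.map_map, List.map_map]
    congr 1
    · simp
    · refine List.map_congr_left fun k _ => ?_
      simp only [Function.comp, MulAut.conj_apply, inv_simple, Nat.succ_eq_add_one]
      rw [← mul_assoc, mul_mul_pow_comm, pow_succ]
      simp [mul_assoc]

theorem map_conj_rightInvSeq (ω : List B) :
    (cs.rightInvSeq ω).map (MulAut.conj (cs.wordProd ω)) = cs.leftInvSeq ω := by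
  induction ω with
  | nil => rfl
  | cons i ω ih =>
    rw [rightInvSeq, leftInvSeq, ← ih, List.map_cons, List.map_map]
    congr 1
    · simp [wordProd_cons, mul_assoc]
    · refine List.map_congr_left fun x _ => ?_
      simp [wordProd_cons, mul_assoc]

theorem rightInvSeq_eq_map (ω : List B) :
    cs.rightInvSeq ω = (cs.leftInvSeq ω).map (MulAut.conj (cs.wordProd ω)⁻¹) := by
  rw [← map_conj_rightInvSeq, List.map_map]
  conv_lhs => rw [← List.map_id (cs.rightInvSeq ω)]
  refine List.map_congr_left fun x _ => ?_
  simp [mul_assoc]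

theorem wordProd_altList_comm {u v : B} {n : ℕ} (h : (cs.simple u * cs.simple v) ^ n = 1) :
    cs.wordProd (altList u v n) = cs.wordProd (altList v u n) := by
  rw [wordProd_altList, wordProd_altList, ← mul_inv_eq_one,
    LabelledGraph.altProd_mul_inv_altProd (cs.simple_mul_simple_self u)
      (cs.simple_mul_simple_self v), h]

theorem rightInvSeq_altList_perm {u v : B} {n : ℕ} (h : (cs.simple u * cs.simple v) ^ n = 1) :
    (cs.rightInvSeq (altList u v n)).Perm (cs.rightInvSeq (altList v u n)) := by
  rw [rightInvSeq_eq_map, rightInvSeq_eq_map, cs.wordProd_altList_comm h]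
  refine List.Perm.map _ ?_
  rw [leftInvSeq_altList, leftInvSeq_altList]
  have : (List.range n).map (fun k => (cs.simple v * cs.simple u) ^ k * cs.simple v)
      = ((List.range n).map fun k => (cs.simple u * cs.simple v) ^ k * cs.simple u).reverse := by
    rw [← List.map_reverse]
    apply List.ext_getElem
    · simp
    · intro k h1 h2
      have hk : k < n := by simpa using h1
      simp only [List.getElem_map, List.getElem_range, List.getElem_reverse, List.length_range]
      have e : cs.simple v * cs.simple u = (cs.simple u * cs.simple v)⁻¹ := by simp
      have e2 : (cs.simple u * cs.simple v) ^ (n - 1 - k)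
          = ((cs.simple u * cs.simple v) ^ (k + 1))⁻¹ := by
        rw [eq_inv_iff_mul_eq_one, ← pow_add, ← h]
        congr 1
        omega
      rw [e, e2, inv_pow, pow_succ', mul_inv_rev]
      simp [mul_assoc]
  rw [this]
  exact (List.reverse_perm _).symm

open scoped Classical in
/-- The permutation `(x, n) ↦ (s x s, n + [x = s])` of `W × R`, for `s` a simple reflection. -/
noncomputable def reflPerm (R : Type*) [CommRing R] (i : B) : Equiv.Perm (W × R) where
  toFun p := (cs.simple i * p.1 * cs.simple i, p.2 + if p.1 = cs.simple i then 1 else 0)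
  invFun p := (cs.simple i * p.1 * cs.simple i, p.2 - if p.1 = cs.simple i then 1 else 0)
  left_inv p := by
    have : cs.simple i * p.1 * cs.simple i = cs.simple i ↔ p.1 = cs.simple i := by
      rw [mul_eq_right, mul_eq_one_iff_inv_eq, inv_simple, eq_comm]
    ext <;> simp [mul_assoc, ← this]
  right_inv p := by
    have : cs.simple i * p.1 * cs.simple i = cs.simple i ↔ p.1 = cs.simple i := by
      rw [mul_eq_right, mul_eq_one_iff_inv_eq, inv_simple, eq_comm]
    ext <;> simp [mul_assoc, ← this]

open scoped Classical in
theorem prod_reflPerm_apply (R : Type*) [CommRing R] (ω : List B) (x : W) (n : R) :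
    (ω.map (cs.reflPerm R)).prod (x, n) =
      (cs.wordProd ω * x * (cs.wordProd ω)⁻¹, n + ((cs.rightInvSeq ω).count x : ℕ)) := by
  induction ω with
  | nil => simp
  | cons i ω ih =>
    have e : cs.wordProd ω * x * (cs.wordProd ω)⁻¹ = cs.simple i ↔
        (cs.wordProd ω)⁻¹ * cs.simple i * cs.wordProd ω = x := by
      constructor
      · intro h; rw [← h]; simp [mul_assoc]
      · intro h; rw [← h]; simp [mul_assoc]
    rw [List.map_cons, List.prod_cons, Equiv.Perm.mul_apply, ih]
    simp only [reflPerm, Equiv.coe_fn_mk, rightInvSeq, List.count_cons, wordProd_cons, beq_iff_eq, e]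
    ext
    · simp [mul_assoc]
    · simp [add_assoc]

theorem reflPerm_isLiftable : M.IsLiftable (cs.reflPerm (ZMod 2)) := by
  classical
  intro u v
  ext1 ⟨x, n⟩
  set m := M u v
  have hm : (cs.simple u * cs.simple v) ^ m = 1 := cs.simple_mul_simple_pow u v
  rw [← prod_map_altList_two_mul, prod_reflPerm_apply]
  have h1 : cs.wordProd (altList u v (2 * m)) = 1 := by
    rw [wordProd, prod_map_altList_two_mul, hm]
  rw [rightInvSeq_eq_map, h1, leftInvSeq_altList, two_mul, List.range_add, List.map_append,
    List.map_map]
  have h2 : (List.range m).map ((fun k => (cs.simple u * cs.simple v) ^ k * cs.simple u) ∘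
      fun x => m + x) = (List.range m).map
        (fun k => (cs.simple u * cs.simple v) ^ k * cs.simple u) := by
    refine List.map_congr_left fun k _ => ?_
    simp [pow_add, hm]
  rw [h2, List.map_append, List.count_append, Nat.cast_add, CharTwo.add_self_eq_zero]
  simp

/-- The exchange condition. -/
theorem exists_split_of_isLeftDescent (ω : List B) {i : B}
    (h : cs.IsLeftDescent (cs.wordProd ω) i) :
    ∃ a k b, ω = a ++ k :: b ∧ cs.simple i * cs.wordProd ω = cs.wordProd (a ++ b) := by
  classical
  suffices hmem : cs.simple i ∈ cs.leftInvSeq ω by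
    obtain ⟨j, hj, e⟩ := List.getElem_of_mem hmem
    rw [length_leftInvSeq] at hj
    refine ⟨ω.take j, ω[j], ω.drop (j + 1), by simp, ?_⟩
    rw [← List.eraseIdx_eq_take_drop_succ, ← getD_leftInvSeq_mul_wordProd, ← e,
      List.getD_eq_getElem]
  obtain ⟨ω', hω', e'⟩ := cs.exists_isReduced (cs.simple i * cs.wordProd ω)
  have e : cs.wordProd (i :: ω') = cs.wordProd ω := by
    rw [wordProd_cons, ← e']; simp
  have hred : cs.IsReduced (i :: ω') := by
    rw [IsReduced, e]
    have := hω'.eq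
    rw [← e'] at this
    rw [isLeftDescent_iff, this] at h
    simp [← h]
  set t := (cs.wordProd ω)⁻¹ * cs.simple i * cs.wordProd ω with ht
  have key : ∀ ω₁ ω₂ : List B, cs.wordProd ω₁ = cs.wordProd ω₂ →
      ((cs.rightInvSeq ω₁).count t : ZMod 2) = ((cs.rightInvSeq ω₂).count t : ℕ) := by
    intro ω₁ ω₂ h12
    have hl : ∀ η : List B, cs.lift ⟨_, cs.reflPerm_isLiftable⟩ (cs.wordProd η)
        = (η.map (cs.reflPerm (ZMod 2))).prod := by
      intro η
      rw [wordProd, map_list_prod, List.map_map]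
      congr 1
      refine List.map_congr_left fun k _ => ?_
      simp
    have := congrArg (fun g => (cs.lift ⟨_, cs.reflPerm_isLiftable⟩ g (t, 0)).2) h12
    simpa only [hl, prod_reflPerm_apply, zero_add] using this
  have h1 : (cs.rightInvSeq (i :: ω')).count t = 1 := by
    refine List.count_eq_one_of_mem hred.nodup_rightInvSeq ?_
    rw [rightInvSeq, ht, ← e, wordProd_cons]
    simp [mul_assoc]
  have h2 := key _ _ e
  rw [h1] at h2
  have h3 : t ∈ cs.rightInvSeq ω := by
    rw [← List.count_pos_iff, Nat.pos_iff_ne_zero]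
    intro h0
    rw [h0] at h2
    exact absurd h2 (by decide)
  rw [← map_conj_rightInvSeq]
  refine List.mem_map.mpr ⟨t, h3, ?_⟩
  simp [ht, mul_assoc]

/-- The exchange condition, on the right. -/
theorem exists_split_of_isRightDescent (ω : List B) {i : B}
    (h : cs.IsRightDescent (cs.wordProd ω) i) :
    ∃ a k b, ω = a ++ k :: b ∧ cs.wordProd ω * cs.simple i = cs.wordProd (a ++ b) := by
  rw [← isLeftDescent_inv_iff, ← wordProd_reverse] at h
  obtain ⟨a, k, b, hω, e⟩ := cs.exists_split_of_isLeftDescent _ h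
  refine ⟨b.reverse, k, a.reverse, ?_, ?_⟩
  · rw [← List.reverse_reverse ω, hω]
    simp
  · have e2 := congrArg (·⁻¹) e
    simp only [mul_inv_rev, wordProd_reverse, inv_inv, inv_simple] at e2
    rw [e2, ← wordProd_reverse, List.reverse_append]

open Real in
theorem _root_.Real.sum_sin_add_eq_zero {m : ℕ} (hm : 2 ≤ m) (c : ℝ) :
    ∑ k ∈ Finset.range m, sin (2 * k * (π / m) + c) = 0 := by
  have hm0 : (m : ℝ) ≠ 0 := by positivity
  have hs : sin (π / m) ≠ 0 := by
    refine (sin_pos_of_pos_of_lt_pi (by positivity) ?_).ne'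
    exact div_lt_self pi_pos (by exact_mod_cast hm)
  have key : ∀ n : ℕ, 2 * sin (π / m) * ∑ k ∈ Finset.range n, sin (2 * k * (π / m) + c) =
      cos (c - π / m) - cos (2 * n * (π / m) + (c - π / m)) := by
    intro n
    induction n with
    | zero => simp
    | succ n ih =>
      rw [Finset.sum_range_succ, mul_add, ih]
      have e1 : 2 * (n : ℝ) * (π / m) + (c - π / m) = (2 * n * (π / m) + c) - π / m := by ring
      have e2 : 2 * ((n + 1 : ℕ) : ℝ) * (π / m) + (c - π / m)
          = (2 * n * (π / m) + c) + π / m := by push_cast; ring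
      rw [e1, e2, cos_sub (2 * (n : ℝ) * (π / m) + c), cos_add (2 * (n : ℝ) * (π / m) + c)]
      ring
  have := key m
  have e : 2 * (m : ℝ) * (π / m) + (c - π / m) = (c - π / m) + 2 * π := by
    field_simp
    ring
  rw [e, cos_add_two_pi, sub_self] at this
  exact (mul_eq_zero.mp this).resolve_left (mul_ne_zero two_ne_zero hs)

/-- The off-diagonal coefficients `2 cos (π / m)` (equal to `2` for `m = ∞`) and diagonal
coefficients `-2` of the dual geometric representation. -/
noncomputable def geomCoeff (M : CoxeterMatrix B) (i j : B) : ℝ :=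
  2 * Real.cos (Real.pi / M i j)

theorem geomCoeff_self (M : CoxeterMatrix B) (i : B) : geomCoeff M i i = -2 := by
  simp [geomCoeff]

theorem geomCoeff_symm (M : CoxeterMatrix B) (i j : B) : geomCoeff M i j = geomCoeff M j i := by
  rw [geomCoeff, geomCoeff, M.symmetric]

/-- The action of a simple reflection in the dual geometric representation. -/
noncomputable def geomRefl (M : CoxeterMatrix B) (i : B) : Module.End ℝ (B → ℝ) where
  toFun f v := f v + geomCoeff M i v * f i
  map_add' f g := by ext v; simp; ring
  map_smul' r f := by ext v; simp; ring

theorem geomRefl_apply (M : CoxeterMatrix B) (i : B) (f : B → ℝ) (v : B) :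
    geomRefl M i f v = f v + geomCoeff M i v * f i := rfl

theorem geomRefl_mul_apply (M : CoxeterMatrix B) (i j : B) (f : B → ℝ) (v : B) :
    (geomRefl M i * geomRefl M j) f v = f v + geomCoeff M j v * f j +
      geomCoeff M i v * (f i + geomCoeff M i j * f j) := by
  rw [Module.End.mul_apply, geomRefl_apply, geomRefl_apply, geomRefl_apply, geomCoeff_symm M i j]

open Real in
theorem geomRefl_mul_pow_apply (M : CoxeterMatrix B) (i j : B) (f : B → ℝ) (k : ℕ) :
    sin (π / M i j) * ((geomRefl M i * geomRefl M j) ^ k) f j =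
      f j * sin ((2 * k + 1) * (π / M i j)) + f i * sin (2 * k * (π / M i j)) ∧
    sin (π / M i j) * ((geomRefl M i * geomRefl M j) ^ k) f i =
      - (f j * sin (2 * k * (π / M i j)) + f i * sin ((2 * k - 1) * (π / M i j))) := by
  induction k with
  | zero => constructor <;> simp [mul_comm]
  | succ k ih =>
    obtain ⟨h1, h2⟩ := ih
    set φ := π / M i j with hφ
    have e1 : (2 * ((k + 1 : ℕ) : ℝ) + 1) * φ = 2 * k * φ + φ + φ + φ := by push_cast; ring
    have e2 : 2 * ((k + 1 : ℕ) : ℝ) * φ = 2 * k * φ + φ + φ := by push_cast; ring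
    have e3 : (2 * ((k + 1 : ℕ) : ℝ) - 1) * φ = 2 * k * φ + φ := by push_cast; ring
    have e4 : (2 * (k : ℝ) + 1) * φ = 2 * k * φ + φ := by ring
    have e5 : (2 * (k : ℝ) - 1) * φ = 2 * k * φ - φ := by ring
    rw [pow_succ', Module.End.mul_apply, geomRefl_mul_apply, geomRefl_mul_apply, e1, e2, e3]
    rw [e4] at h1
    rw [e5] at h2
    have ha : geomCoeff M i j = 2 * cos φ := rfl
    rw [geomCoeff_self, geomCoeff_self, geomCoeff_symm M j i, ha]
    simp only [sin_add, sin_sub, cos_add] at h1 h2 ⊢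
    set x := ((geomRefl M i * geomRefl M j) ^ k) f j
    set y := ((geomRefl M i * geomRefl M j) ^ k) f i
    have hsc := sin_sq_add_cos_sq φ
    constructor
    · linear_combination (4 * cos φ ^ 2 - 1) * h1 + 2 * cos φ * h2
        + (f j * cos (2 * k * φ) * sin φ + 3 * f j * sin (2 * k * φ) * cos φ
          + f i * sin (2 * k * φ)) * hsc
    · linear_combination (-2 * cos φ) * h1 - h2
        - f j * sin (2 * k * φ) * hsc

open Real in
theorem geomRefl_isLiftable (M : CoxeterMatrix B) : M.IsLiftable (geomRefl M) := by
  intro i j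
  ext1 f
  ext v
  have step : ∀ k : ℕ, ((geomRefl M i * geomRefl M j) ^ k) f v = f v
      + geomCoeff M j v * ∑ l ∈ Finset.range k, ((geomRefl M i * geomRefl M j) ^ l) f j
      + geomCoeff M i v * (∑ l ∈ Finset.range k, ((geomRefl M i * geomRefl M j) ^ l) f i +
        geomCoeff M i j * ∑ l ∈ Finset.range k, ((geomRefl M i * geomRefl M j) ^ l) f j) := by
    intro k
    induction k with
    | zero => simp
    | succ k ih =>
      rw [pow_succ', Module.End.mul_apply, geomRefl_mul_apply, ih, Finset.sum_range_succ,
        Finset.sum_range_succ]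
      ring
  rcases eq_or_ne i j with rfl | hij
  · rw [M.diagonal, pow_one, geomRefl_mul_apply, geomCoeff_self, Module.End.one_apply]
    ring
  rcases Nat.eq_zero_or_pos (M i j) with h0 | hpos
  · rw [h0, pow_zero]
  have h2 : 2 ≤ M i j := by
    have := M.off_diagonal i j hij
    omega
  have hs : sin (π / M i j) ≠ 0 := by
    refine (sin_pos_of_pos_of_lt_pi (by positivity) ?_).ne'
    exact div_lt_self pi_pos (by exact_mod_cast h2)
  have S1 : ∑ l ∈ Finset.range (M i j), ((geomRefl M i * geomRefl M j) ^ l) f j = 0 := by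
    refine (mul_eq_zero.mp (?_ : sin (π / M i j) * _ = 0)).resolve_left hs
    rw [Finset.mul_sum]
    simp only [(geomRefl_mul_pow_apply M i j f _).1]
    rw [Finset.sum_add_distrib, ← Finset.mul_sum, ← Finset.mul_sum]
    have e1 := sum_sin_add_eq_zero h2 (π / M i j)
    have e2 := sum_sin_add_eq_zero h2 0
    simp only [add_zero] at e2
    simp only [add_mul, one_mul]
    rw [e1, e2]
    simp
  have S2 : ∑ l ∈ Finset.range (M i j), ((geomRefl M i * geomRefl M j) ^ l) f i = 0 := by
    refine (mul_eq_zero.mp (?_ : sin (π / M i j) * _ = 0)).resolve_left hs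
    rw [Finset.mul_sum]
    simp only [(geomRefl_mul_pow_apply M i j f _).2]
    rw [Finset.sum_neg_distrib, Finset.sum_add_distrib, ← Finset.mul_sum, ← Finset.mul_sum]
    have e1 := sum_sin_add_eq_zero h2 (-(π / M i j))
    have e2 := sum_sin_add_eq_zero h2 0
    simp only [add_zero] at e2
    simp only [sub_mul, one_mul]
    simp only [sub_eq_add_neg]
    rw [e1, e2]
    simp
  rw [step, S1, S2]
  simp

open Real in
/-- The order of `s_i s_j` is a multiple of `M i j` (with `0` standing for `∞`). -/
theorem dvd_of_simple_mul_simple_pow_eq_one {i j : B} {n : ℕ}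
    (h : (cs.simple i * cs.simple j) ^ n = 1) : M i j ∣ n := by
  classical
  rcases eq_or_ne i j with rfl | hij
  · simp
  have hr := congrArg (cs.lift ⟨_, geomRefl_isLiftable M⟩) h
  rw [map_pow, map_mul, lift_apply_simple, lift_apply_simple, map_one] at hr
  set f : B → ℝ := Pi.single j 1 with hf
  have fi : f i = 0 := by simp [hf, hij]
  have fj : f j = 1 := by simp [hf]
  rcases Nat.eq_zero_or_pos (M i j) with h0 | hpos
  · have ha : geomCoeff M i j = 2 := by simp [geomCoeff, h0]
    have key : ∀ k : ℕ, ((geomRefl M i * geomRefl M j) ^ k) f j = 2 * k + 1 ∧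
        ((geomRefl M i * geomRefl M j) ^ k) f i = - (2 * k) := by
      intro k
      induction k with
      | zero => simp [fi, fj]
      | succ k ih =>
        rw [pow_succ', Module.End.mul_apply, geomRefl_mul_apply, geomRefl_mul_apply, ih.1, ih.2,
          geomCoeff_self, geomCoeff_self, geomCoeff_symm M j i, ha]
        push_cast
        constructor <;> ring
    have := (key n).1
    rw [hr, Module.End.one_apply, fj] at this
    have hn : n = 0 := by
      have : (n : ℝ) = 0 := by linarith
      exact_mod_cast this
    simp [hn]
  · have h2 : 2 ≤ M i j := by
      have := M.off_diagonal i j hij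
      omega
    have hs : sin (π / M i j) ≠ 0 := by
      refine (sin_pos_of_pos_of_lt_pi (by positivity) ?_).ne'
      exact div_lt_self pi_pos (by exact_mod_cast h2)
    obtain ⟨k1, k2⟩ := geomRefl_mul_pow_apply M i j f n
    rw [hr, Module.End.one_apply] at k1 k2
    rw [fi, fj] at k1 k2
    have hsin : sin (2 * n * (π / M i j)) = 0 := by linarith
    have e : (2 * (n : ℝ) + 1) * (π / M i j) = 2 * n * (π / M i j) + π / M i j := by ring
    rw [e, sin_add, hsin] at k1
    have hcos : cos (2 * n * (π / M i j)) = 1 := by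
      apply mul_right_cancel₀ hs
      linarith
    obtain ⟨z, hz⟩ := (cos_eq_one_iff _).mp hcos
    have hm0 : (M i j : ℝ) ≠ 0 := by positivity
    have : (n : ℝ) = z * M i j := by
      field_simp at hz
      linarith
    have hz' : (n : ℤ) = z * (M i j : ℕ) := by exact_mod_cast this
    exact Int.natCast_dvd_natCast.mp ⟨z, by rw [hz', mul_comm]⟩

theorem simple_injective : Function.Injective cs.simple := by
  intro i j h
  by_contra hij
  have := cs.dvd_of_simple_mul_simple_pow_eq_one (i := i) (j := j) (n := 1) (by simp [h])
  exact M.off_diagonal i j hij (Nat.dvd_one.mp this)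

/-- The standard parabolic subgroup generated by the simple reflections in `J`. -/
def parabolic (J : Set B) : Subgroup W := Subgroup.closure (cs.simple '' J)

variable {J K : Set B}

theorem simple_mem_parabolic {i : B} (hi : i ∈ J) : cs.simple i ∈ cs.parabolic J :=
  Subgroup.subset_closure ⟨i, hi, rfl⟩

theorem wordProd_mem_parabolic {ω : List B} (h : ∀ i ∈ ω, i ∈ J) :
    cs.wordProd ω ∈ cs.parabolic J := by
  refine Subgroup.list_prod_mem _ fun x hx => ?_
  obtain ⟨i, hi, rfl⟩ := List.mem_map.mp hx
  exact cs.simple_mem_parabolic (h i hi)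

theorem exists_isReduced_sublist (ω : List B) :
    ∃ ω' : List B, ω'.Sublist ω ∧ cs.IsReduced ω' ∧ cs.wordProd ω' = cs.wordProd ω := by
  induction ω with
  | nil => exact ⟨[], List.Sublist.slnil, by simp [IsReduced], rfl⟩
  | cons i ω ih =>
    obtain ⟨η, hsub, hred, e⟩ := ih
    by_cases hd : cs.IsLeftDescent (cs.wordProd η) i
    · obtain ⟨a, k, b, rfl, e2⟩ := cs.exists_split_of_isLeftDescent _ hd
      refine ⟨a ++ b, ?_, ?_, ?_⟩
      · refine List.Sublist.trans ?_ (hsub.cons i)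
        exact (List.Sublist.refl a).append (List.sublist_cons_self k b)
      · rw [isLeftDescent_iff, e2, hred.eq] at hd
        simp only [IsReduced]
        simp at hd ⊢
        omega
      · rw [← e2, wordProd_cons, e]
    · refine ⟨i :: η, hsub.cons_cons i, ?_, by rw [wordProd_cons, wordProd_cons, e]⟩
      rw [not_isLeftDescent_iff, hred.eq] at hd
      rw [IsReduced, wordProd_cons, hd, List.length_cons]

theorem exists_isReduced_of_mem_parabolic {x : W} (hx : x ∈ cs.parabolic J) :
    ∃ ω : List B, (∀ i ∈ ω, i ∈ J) ∧ cs.IsReduced ω ∧ cs.wordProd ω = x := by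
  suffices h : ∃ ω : List B, (∀ i ∈ ω, i ∈ J) ∧ cs.wordProd ω = x by
    obtain ⟨ω, h1, h2⟩ := h
    obtain ⟨η, hs, hr, e⟩ := cs.exists_isReduced_sublist ω
    exact ⟨η, fun i hi => h1 i (hs.subset hi), hr, e.trans h2⟩
  induction hx using Subgroup.closure_induction with
  | mem x hx =>
    obtain ⟨i, hi, rfl⟩ := hx
    exact ⟨[i], by simpa using hi, by simp⟩
  | one => exact ⟨[], by simp, by simp⟩
  | mul x y _ _ hx hy =>
    obtain ⟨a, ha, rfl⟩ := hx
    obtain ⟨b, hb, rfl⟩ := hy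
    refine ⟨a ++ b, fun i hi => ?_, cs.wordProd_append a b⟩
    exact (List.mem_append.mp hi).elim (ha i) (hb i)
  | inv x _ hx =>
    obtain ⟨a, ha, rfl⟩ := hx
    exact ⟨a.reverse, fun i hi => ha i (List.mem_reverse.mp hi), by simp⟩

theorem exists_simple_of_mem_parabolic {x : W} (hx : x ∈ cs.parabolic J)
    (h1 : cs.length x = 1) : ∃ j ∈ J, x = cs.simple j := by
  obtain ⟨ω, hω, hr, rfl⟩ := cs.exists_isReduced_of_mem_parabolic hx
  rw [hr.eq] at h1
  obtain ⟨j, rfl⟩ := List.length_eq_one_iff.mp h1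
  exact ⟨j, hω j (by simp), by simp⟩

theorem mem_of_simple_mem_parabolic {i : B} (h : cs.simple i ∈ cs.parabolic J) : i ∈ J := by
  obtain ⟨j, hj, e⟩ := cs.exists_simple_of_mem_parabolic h (cs.length_simple i)
  rwa [cs.simple_injective e]

theorem exists_mem_of_isRightDescent {x : W} (hx : x ∈ cs.parabolic J) (h : x ≠ 1) :
    ∃ j ∈ J, cs.IsRightDescent x j := by
  obtain ⟨ω, hω, hr, rfl⟩ := cs.exists_isReduced_of_mem_parabolic hx
  rcases List.eq_nil_or_concat ω with rfl | ⟨η, j, rfl⟩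
  · simp at h
  · refine ⟨j, hω j (by simp), ?_⟩
    rw [IsRightDescent, hr.eq]
    have := cs.length_wordProd_le η
    simp only [List.concat_eq_append, wordProd_append, wordProd_singleton,
      simple_mul_simple_cancel_right, List.length_append, List.length_singleton]
    omega

theorem length_mul_of_forall_le {x w : W} (hx : x ∈ cs.parabolic J)
    (hw : ∀ y ∈ cs.parabolic J, cs.length w ≤ cs.length (w * y)) :
    cs.length (w * x) = cs.length w + cs.length x := by
  obtain ⟨ω, hω, hr, rfl⟩ := cs.exists_isReduced_of_mem_parabolic hx
  clear hx
  induction ω using List.reverseRecOn with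
  | nil => simp
  | append_singleton ω i ih =>
    have hr' : cs.IsReduced ω := by
      have := hr.take ω.length
      simpa using this
    have hl := ih (fun j hj => hω j (by simp [hj])) hr'
    by_cases hd : cs.IsRightDescent (w * cs.wordProd ω) i
    · exfalso
      obtain ⟨η, hη, e⟩ := cs.exists_isReduced w
      have hd' := hd
      rw [e, ← wordProd_append] at hd'
      obtain ⟨a, k, b, h1, h2⟩ := cs.exists_split_of_isRightDescent _ hd'
      rw [List.append_eq_append_iff] at h1
      have case1 : ∀ c d, ω = c ++ k :: d → cs.wordProd (η ++ ω) * cs.simple i =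
          cs.wordProd (η ++ (c ++ d)) → False := by
        rintro c d rfl h2
        rw [cs.wordProd_append η, cs.wordProd_append η, mul_assoc] at h2
        have h3 := mul_left_cancel h2
        have := cs.length_wordProd_le (c ++ d)
        rw [← h3, ← wordProd_concat, List.concat_eq_append, hr.eq] at this
        simp at this
      rcases h1 with ⟨c, rfl, h1⟩ | ⟨c, h0, h1⟩
      · exact case1 c b h1 (by simpa using h2)
      · rcases c with _ | ⟨k', c⟩
        · exact case1 [] b (by simpa using h1.symm) (by simpa [h0] using h2)
        · simp only [List.cons_append, List.cons.injEq] at h1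
          obtain ⟨rfl, rfl⟩ := h1
          have h3 : cs.wordProd (a ++ c) =
              w * (cs.wordProd ω * cs.simple i * (cs.wordProd ω)⁻¹) := by
            rw [e, ← mul_assoc, ← mul_assoc, ← cs.wordProd_append η ω, h2, eq_mul_inv_iff_mul_eq,
              ← wordProd_append, List.append_assoc]
          have h4 := cs.length_wordProd_le (a ++ c)
          have hmem : cs.wordProd ω ∈ cs.parabolic J :=
            cs.wordProd_mem_parabolic fun j hj => hω j (by simp [hj])
          have h5 := hw _ (mul_mem (mul_mem hmem (cs.simple_mem_parabolic (hω i (by simp))))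
            (inv_mem hmem))
          rw [← h3, e, hη.eq, h0] at h5
          simp at h4 h5
          omega
    · rw [not_isRightDescent_iff] at hd
      rw [hr.eq, wordProd_append, wordProd_singleton, ← mul_assoc, hd, hl, hr'.eq]
      simp [add_assoc]

/-- The minimal length representatives of the left cosets of the parabolic subgroup of `K`. -/
def minReps (K : Set B) : Set W := {w | ∀ k ∈ K, ¬ cs.IsRightDescent w k}

theorem exists_mul_mem_minReps_aux (K : Set B) (w : W) :
    ∃ x ∈ cs.parabolic K, ∀ y ∈ cs.parabolic K, cs.length (w * x) ≤ cs.length (w * x * y) := by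
  classical
  have hex : ∃ n, ∃ x ∈ cs.parabolic K, cs.length (w * x) = n := ⟨_, 1, one_mem _, rfl⟩
  obtain ⟨x, hx, e⟩ := Nat.find_spec hex
  refine ⟨x, hx, fun y hy => ?_⟩
  rw [e]
  exact Nat.find_min' hex ⟨x * y, mul_mem hx hy, by rw [mul_assoc]⟩

theorem mem_minReps_of_forall_le {w : W}
    (hw : ∀ y ∈ cs.parabolic K, cs.length w ≤ cs.length (w * y)) : w ∈ cs.minReps K :=
  fun _ hk h => absurd (hw _ (cs.simple_mem_parabolic hk)) (not_le.mpr h)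

theorem exists_eq_mul_of_minReps (K : Set B) (w : W) :
    ∃ d ∈ cs.minReps K, ∃ x ∈ cs.parabolic K, w = d * x := by
  obtain ⟨x, hx, h⟩ := cs.exists_mul_mem_minReps_aux K w
  exact ⟨_, cs.mem_minReps_of_forall_le h, x⁻¹, inv_mem hx, by simp⟩

theorem length_mul_of_mem_minReps {w x : W} (hw : w ∈ cs.minReps K)
    (hx : x ∈ cs.parabolic K) : cs.length (w * x) = cs.length w + cs.length x := by
  obtain ⟨y, hy, h⟩ := cs.exists_mul_mem_minReps_aux K w
  have key : y⁻¹ = 1 := by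
    by_contra hne
    obtain ⟨k, hk, hd⟩ := cs.exists_mem_of_isRightDescent (inv_mem hy) hne
    refine hw k hk ?_
    have e1 := cs.length_mul_of_forall_le (inv_mem hy) h
    have e2 := cs.length_mul_of_forall_le (mul_mem (inv_mem hy) (cs.simple_mem_parabolic hk)) h
    have e3 : w * y * (y⁻¹ * cs.simple k) = w * cs.simple k := by group
    have e4 : w * y * y⁻¹ = w := by group
    rw [e3] at e2
    rw [e4] at e1
    rw [IsRightDescent] at hd ⊢
    omega
  obtain rfl : y = 1 := inv_eq_one.mp key
  rw [mul_one] at h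
  exact cs.length_mul_of_forall_le hx h

theorem eq_of_mem_minReps {w w' : W} (hw : w ∈ cs.minReps K) (hw' : w' ∈ cs.minReps K)
    (h : w⁻¹ * w' ∈ cs.parabolic K) : w = w' := by
  have e1 := cs.length_mul_of_mem_minReps hw h
  have e2 := cs.length_mul_of_mem_minReps hw' (inv_mem h)
  have e3 : cs.length (w⁻¹ * w') = 0 := by
    rw [length_inv] at e2
    rw [mul_inv_cancel_left] at e1
    simp only [mul_inv_rev, inv_inv, mul_inv_cancel_left] at e2
    omega
  rw [length_eq_zero_iff] at e3
  exact inv_mul_eq_one.mp e3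

/-- Deodhar's lemma. -/
theorem exists_simple_mul_eq_of_not_mem_minReps {w : W} {i : B} (hw : w ∈ cs.minReps K)
    (h : cs.simple i * w ∉ cs.minReps K) :
    ∃ k ∈ K, cs.simple i * w = w * cs.simple k := by
  simp only [minReps, Set.mem_ofPred_eq, not_forall, not_not] at h
  obtain ⟨k, hk, hd⟩ := h
  refine ⟨k, hk, ?_⟩
  have h1 := hw k hk
  by_cases hl : cs.IsLeftDescent w i
  · exfalso
    rw [isRightDescent_iff] at hd
    rw [not_isRightDescent_iff] at h1
    rw [isLeftDescent_iff] at hl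
    have := cs.length_simple_mul (w * cs.simple k) i
    rw [← mul_assoc] at this
    omega
  · obtain ⟨ω, hω, rfl⟩ := cs.exists_isReduced w
    rw [← wordProd_cons] at hd
    obtain ⟨a, j, b, e1, e2⟩ := cs.exists_split_of_isRightDescent _ hd
    rcases a with _ | ⟨c, a⟩
    · simp only [List.nil_append, List.cons.injEq] at e1 e2
      obtain ⟨rfl, rfl⟩ := e1
      rw [wordProd_cons] at e2
      rw [eq_comm, ← e2, simple_mul_simple_cancel_right, e2]
    · exfalso
      simp only [List.cons_append, List.cons.injEq] at e1
      obtain ⟨rfl, rfl⟩ := e1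
      rw [List.cons_append, wordProd_cons, wordProd_cons, mul_assoc] at e2
      have e3 := mul_left_cancel e2
      rw [not_isRightDescent_iff, e3, hω.eq] at h1
      have := cs.length_wordProd_le (a ++ b)
      simp at h1 this
      omega

theorem mem_or_exists_of_mem_minReps {w : W} (i : B) (hw : w ∈ cs.minReps K) :
    cs.simple i * w ∈ cs.minReps K ∨ ∃ k ∈ K, cs.simple i * w = w * cs.simple k := by
  by_cases h : cs.simple i * w ∈ cs.minReps K
  · exact Or.inl h
  · exact Or.inr (cs.exists_simple_mul_eq_of_not_mem_minReps hw h)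

theorem simple_conj_not_mem_parabolic {s t : B} (hs : s ∉ J) (hst : s ≠ t) (hM : M s t ≠ 2) :
    cs.simple s * cs.simple t * cs.simple s ∉ cs.parabolic J := by
  intro hmem
  have hne : (cs.simple s * cs.simple t) ^ 2 ≠ 1 := by
    intro h
    have h1 := cs.dvd_of_simple_mul_simple_pow_eq_one h
    have h2 := M.off_diagonal s t hst
    rcases (Nat.dvd_prime Nat.prime_two).mp h1 with h | h <;> contradiction
  have hP : cs.simple s * cs.simple t * cs.simple s ∈ cs.parabolic {s, t} :=
    mul_mem (mul_mem (cs.simple_mem_parabolic (by simp)) (cs.simple_mem_parabolic (by simp)))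
      (cs.simple_mem_parabolic (by simp))
  have hl1 : cs.length (cs.simple s * cs.simple t * cs.simple s) ≠ 1 := by
    intro h1
    obtain ⟨q, rfl | rfl, e⟩ := cs.exists_simple_of_mem_parabolic hP h1
    · rw [mul_eq_right, mul_eq_one_iff_eq_inv, inv_simple] at e
      exact hst (cs.simple_injective e)
    · apply hne
      rw [pow_two, ← mul_assoc, e, simple_mul_simple_self]
  have hd : cs.IsLeftDescent (cs.simple s * cs.simple t * cs.simple s) s := by
    by_contra hd
    rw [not_isLeftDescent_iff] at hd
    simp only [mul_assoc, simple_mul_simple_cancel_left] at hd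
    have h2 := cs.length_mul_le (cs.simple t) (cs.simple s)
    rw [length_simple, length_simple] at h2
    rw [mul_assoc] at hl1
    have h0 : cs.length (cs.simple s * (cs.simple t * cs.simple s)) ≠ 0 := by
      intro h
      rw [length_eq_zero_iff, ← mul_assoc, mul_eq_one_iff_eq_inv, inv_simple, mul_eq_left] at h
      simpa [h] using cs.length_simple t
    omega
  obtain ⟨ω, hω, hr, e⟩ := cs.exists_isReduced_of_mem_parabolic hmem
  rw [← e] at hd
  obtain ⟨a, k, b, rfl, e2⟩ := cs.exists_split_of_isLeftDescent _ hd
  apply hs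
  apply cs.mem_of_simple_mem_parabolic
  rw [eq_mul_inv_of_mul_eq e2]
  refine mul_mem (cs.wordProd_mem_parabolic fun i hi => hω i ?_) 
    (inv_mem (cs.wordProd_mem_parabolic hω))
  simp only [List.mem_append, List.mem_cons] at hi ⊢
  tauto

end CoxeterSystem

namespace LabelledGraph

variable {V : Type*} (Γ : LabelledGraph V)

section Lift

variable {G : Type*} [Group G]

/-- The homomorphism out of an Artin group determined by elements satisfying its relations. -/
def artinLift (f : V → G)
    (hf : ∀ u v k, u ≠ v → Γ.m u v = (k : ℕ) → altProd (f u) (f v) k = altProd (f v) (f u) k) :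
    Γ.ArtinGroup →* G :=
  PresentedGroup.toGroup (f := f) (by
    rintro r ⟨u, v, k, huv, hk, rfl⟩
    rw [map_mul, map_inv, altWord, altWord, map_altProd, map_altProd, FreeGroup.lift_apply_of,
      FreeGroup.lift_apply_of, hf u v k huv hk, mul_inv_cancel])

@[simp]
theorem artinLift_σ (f : V → G)
    (hf : ∀ u v k, u ≠ v → Γ.m u v = (k : ℕ) → altProd (f u) (f v) k = altProd (f v) (f u) k)
    (v : V) : Γ.artinLift f hf (Γ.σ v) = f v :=
  PresentedGroup.toGroup.of _

variable {Γ} in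
theorem artinHom_ext {H : Type*} [Group H] {φ ψ : Γ.ArtinGroup →* H}
    (h : ∀ v, φ (Γ.σ v) = ψ (Γ.σ v)) : φ = ψ :=
  PresentedGroup.ext h

theorem altProd_σ_comm {u v : V} {k : ℕ} (huv : u ≠ v) (hk : Γ.m u v = k) :
    altProd (Γ.σ u) (Γ.σ v) k = altProd (Γ.σ v) (Γ.σ u) k := by
  have key : ∀ a b : V, altProd (Γ.σ a) (Γ.σ b) k
      = PresentedGroup.mk Γ.artinRels (altWord a b k) := fun a b => by
    rw [altWord, map_altProd]
    rfl
  rw [key, key, ← mul_inv_eq_one, ← map_inv, ← map_mul]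
  exact (QuotientGroup.eq_one_iff _).mpr
    (Subgroup.subset_normalClosure ⟨u, v, k, huv, hk, rfl⟩)

theorem closure_range_σ : Subgroup.closure (Set.range Γ.σ) = ⊤ :=
  PresentedGroup.closure_range_of _

end Lift

open scoped Classical in
/-- The Coxeter matrix of a labelled graph. -/
noncomputable def coxMatrix : CoxeterMatrix V where
  M := Matrix.of fun u v => if u = v then 1 else (Γ.m u v).toNat
  isSymm := by
    ext u v
    simp [Γ.symm u v, eq_comm]
  diagonal u := by simp
  off_diagonal u v h := by
    have h2 := Γ.two_le u v h
    simp only [Matrix.of_apply, if_neg h]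
    intro h1
    rcases (ENat.toNat_eq_iff one_ne_zero).mp h1 with h1
    rw [h1] at h2
    exact absurd h2 (by decide)

variable {Γ}

theorem coxMatrix_eq {u v : V} {k : ℕ} (huv : u ≠ v) (hk : Γ.m u v = k) :
    Γ.coxMatrix u v = k := by
  simp [coxMatrix, huv, hk]

theorem coxMatrix_eq_iff {u v : V} {k : ℕ} (huv : u ≠ v) (hk : k ≠ 0) :
    Γ.coxMatrix u v = k ↔ Γ.m u v = k := by
  simp [coxMatrix, huv, ENat.toNat_eq_iff hk]

variable (Γ)

theorem coxeterOf_mul_self (v : V) :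
    (PresentedGroup.of v : Γ.CoxeterGroupOf) * PresentedGroup.of v = 1 :=
  (QuotientGroup.eq_one_iff _).mpr
    (Subgroup.subset_normalClosure (Or.inr ⟨v, rfl⟩))

theorem coxeterOf_isLiftable :
    Γ.coxMatrix.IsLiftable fun v => (PresentedGroup.of v : Γ.CoxeterGroupOf) := by
  intro u v
  rcases eq_or_ne u v with rfl | huv
  · rw [coxeterOf_mul_self, one_pow]
  rcases eq_or_ne (Γ.coxMatrix u v) 0 with h0 | h0
  · rw [h0, pow_zero]
  have hk := (coxMatrix_eq_iff huv h0).mp rfl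
  rw [← altProd_mul_inv_altProd (Γ.coxeterOf_mul_self u) (Γ.coxeterOf_mul_self v)]
  have key : ∀ a b : V, altProd (PresentedGroup.of a : Γ.CoxeterGroupOf) (PresentedGroup.of b)
      (Γ.coxMatrix u v) = PresentedGroup.mk _ (altWord a b (Γ.coxMatrix u v)) := fun a b => by
    rw [altWord, map_altProd]
    rfl
  rw [key, key, ← map_inv, ← map_mul]
  exact (QuotientGroup.eq_one_iff _).mpr
    (Subgroup.subset_normalClosure (Or.inl ⟨u, v, _, huv, hk, rfl⟩))

theorem altProd_simple_comm {W : Type*} [Group W] (cs : CoxeterSystem Γ.coxMatrix W) {u v : V}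
    {k : ℕ} (huv : u ≠ v) (hk : Γ.m u v = k) :
    (cs.simple u * cs.simple v) ^ k = 1 := by
  rw [← coxMatrix_eq huv hk, cs.simple_mul_simple_pow]

/-- The homomorphism from the Coxeter group of a labelled graph to that of its matrix. -/
noncomputable def toCoxeterMatrixGroup : Γ.CoxeterGroupOf →* Γ.coxMatrix.Group :=
  PresentedGroup.toGroup (f := Γ.coxMatrix.toCoxeterSystem.simple) (by
    rintro r (⟨u, v, k, huv, hk, rfl⟩ | ⟨v, rfl⟩)
    · rw [map_mul, map_inv, altWord, altWord, map_altProd, map_altProd, FreeGroup.lift_apply_of,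
        FreeGroup.lift_apply_of, altProd_mul_inv_altProd (CoxeterSystem.simple_mul_simple_self _ _)
        (CoxeterSystem.simple_mul_simple_self _ _), Γ.altProd_simple_comm _ huv hk]
    · simpa using CoxeterSystem.simple_mul_simple_self Γ.coxMatrix.toCoxeterSystem v)

/-- The Coxeter system of a labelled graph. -/
noncomputable def coxSystem : CoxeterSystem Γ.coxMatrix Γ.CoxeterGroupOf where
  mulEquiv := MonoidHom.toMulEquiv Γ.toCoxeterMatrixGroup
    (Γ.coxMatrix.toCoxeterSystem.lift ⟨fun v => PresentedGroup.of v, Γ.coxeterOf_isLiftable⟩)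
    (PresentedGroup.ext fun v => by
      rw [MonoidHom.comp_apply, toCoxeterMatrixGroup, PresentedGroup.toGroup.of,
        CoxeterSystem.lift_apply_simple]
      rfl)
    (CoxeterSystem.ext_simple Γ.coxMatrix.toCoxeterSystem fun v => by
      rw [MonoidHom.comp_apply, CoxeterSystem.lift_apply_simple, toCoxeterMatrixGroup,
        PresentedGroup.toGroup.of]
      rfl)

theorem coxSystem_simple (v : V) : Γ.coxSystem.simple v = PresentedGroup.of v :=
  Γ.coxMatrix.toCoxeterSystem.lift_apply_simple Γ.coxeterOf_isLiftable v

@[simp]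
theorem artinToCoxeter_σ (v : V) : Γ.artinToCoxeter (Γ.σ v) = Γ.coxSystem.simple v := by
  rw [coxSystem_simple]
  rfl

/-- The element of the Artin group spelled by a word. -/
def artinWord (ω : List V) : Γ.ArtinGroup := (ω.map Γ.σ).prod

@[simp]
theorem artinWord_nil : Γ.artinWord [] = 1 := rfl

theorem artinWord_cons (v : V) (ω : List V) : Γ.artinWord (v :: ω) = Γ.σ v * Γ.artinWord ω := by
  simp [artinWord]

theorem artinWord_append (ω η : List V) :
    Γ.artinWord (ω ++ η) = Γ.artinWord ω * Γ.artinWord η := by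
  simp [artinWord]

@[simp]
theorem artinToCoxeter_artinWord (ω : List V) :
    Γ.artinToCoxeter (Γ.artinWord ω) = Γ.coxSystem.wordProd ω := by
  induction ω with
  | nil => simp
  | cons v ω ih => rw [artinWord_cons, map_mul, ih, artinToCoxeter_σ, CoxeterSystem.wordProd_cons]

theorem artinWord_altList_comm {u v : V} {k : ℕ} (huv : u ≠ v) (hk : Γ.m u v = k) :
    Γ.artinWord (CoxeterSystem.altList u v k) = Γ.artinWord (CoxeterSystem.altList v u k) := by
  rw [artinWord, artinWord, CoxeterSystem.prod_map_altList, CoxeterSystem.prod_map_altList,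
    Γ.altProd_σ_comm huv hk]

end LabelledGraph

namespace LabelledGraph

open CoxeterSystem

variable {V : Type*} (Γ : LabelledGraph V) (K : Set V)

/-- The part of a generator that is pushed across a minimal coset representative. -/
theorem exists_pushed {w : Γ.coxSystem.minReps K} {i : V}
    (h : Γ.coxSystem.simple i * w ∉ Γ.coxSystem.minReps K) :
    ∃ k : K, Γ.coxSystem.simple i * w = w * Γ.coxSystem.simple k := by
  obtain ⟨k, hk, e⟩ := Γ.coxSystem.exists_simple_mul_eq_of_not_mem_minReps w.2 h
  exact ⟨⟨k, hk⟩, e⟩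

variable {Γ K} in
theorem simple_mul_not_mem_minReps {w : Γ.coxSystem.minReps K} {i : V} {k : K}
    (h : Γ.coxSystem.simple i * w = w * Γ.coxSystem.simple k) :
    Γ.coxSystem.simple i * w ∉ Γ.coxSystem.minReps K := by
  intro hm
  rw [h] at hm
  have h1 := w.2 k k.2
  exact (isRightDescent_iff_not_isRightDescent_mul _ |>.not_left.mp h1) |> hm k k.2

open scoped Classical in
/-- The action of a standard generator on the product of the set of minimal representatives of
the cosets of `W_K` with the Artin group of `Γ_K`. -/
noncomputable def repPerm (i : V) :
    Equiv.Perm (Γ.coxSystem.minReps K × (Γ.induce K).ArtinGroup) where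
  toFun p := if h : Γ.coxSystem.simple i * p.1 ∈ Γ.coxSystem.minReps K then (⟨_, h⟩, p.2)
    else (p.1, (Γ.induce K).σ (Γ.exists_pushed K h).choose * p.2)
  invFun p := if h : Γ.coxSystem.simple i * p.1 ∈ Γ.coxSystem.minReps K then (⟨_, h⟩, p.2)
    else (p.1, ((Γ.induce K).σ (Γ.exists_pushed K h).choose)⁻¹ * p.2)
  left_inv p := by
    by_cases h : Γ.coxSystem.simple i * p.1 ∈ Γ.coxSystem.minReps K <;> simp [h]
  right_inv p := by
    by_cases h : Γ.coxSystem.simple i * p.1 ∈ Γ.coxSystem.minReps K <;> simp [h]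

variable {Γ K}

theorem repPerm_of_mem {i : V} {w : Γ.coxSystem.minReps K} (a : (Γ.induce K).ArtinGroup)
    (h : Γ.coxSystem.simple i * w ∈ Γ.coxSystem.minReps K) :
    Γ.repPerm K i (w, a) = (⟨_, h⟩, a) := by
  simp [repPerm, h]

theorem repPerm_of_eq {i : V} {k : K} {w : Γ.coxSystem.minReps K} (a : (Γ.induce K).ArtinGroup)
    (h : Γ.coxSystem.simple i * w = w * Γ.coxSystem.simple k) :
    Γ.repPerm K i (w, a) = (w, (Γ.induce K).σ k * a) := by
  have hn := simple_mul_not_mem_minReps h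
  have hc := (Γ.exists_pushed K hn).choose_spec
  have : (Γ.exists_pushed K hn).choose = k :=
    Subtype.ext (Γ.coxSystem.simple_injective (mul_left_cancel (hc.symm.trans h)))
  simp only [repPerm, Equiv.coe_fn_mk, dif_neg hn, this]

theorem repPerm_altList_apply {u v : V} {k l : K} {w : Γ.coxSystem.minReps K}
    (hu : Γ.coxSystem.simple u * w = w * Γ.coxSystem.simple k)
    (hv : Γ.coxSystem.simple v * w = w * Γ.coxSystem.simple l)
    (a : (Γ.induce K).ArtinGroup) (n : ℕ) :
    ((altList u v n).map (Γ.repPerm K)).prod (w, a) =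
      (w, altProd ((Γ.induce K).σ k) ((Γ.induce K).σ l) n * a) := by
  induction n generalizing u v k l with
  | zero => simp [altList, altProd]
  | succ n ih =>
    rw [altList, List.map_cons, List.prod_cons, Equiv.Perm.mul_apply, ih hv hu,
      repPerm_of_eq _ hu, altProd, mul_assoc]

theorem altProd_σ_comm_of_conj {u v : V} {k l : K} {w : Γ.CoxeterGroupOf} {n : ℕ} (huv : u ≠ v)
    (hn : Γ.m u v = n)
    (hu : Γ.coxSystem.simple u * w = w * Γ.coxSystem.simple k)
    (hv : Γ.coxSystem.simple v * w = w * Γ.coxSystem.simple l) :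
    altProd ((Γ.induce K).σ k) ((Γ.induce K).σ l) n =
      altProd ((Γ.induce K).σ l) ((Γ.induce K).σ k) n := by
  have hkl : (k : V) ≠ l := by
    intro h
    rw [h, ← hv] at hu
    exact huv (Γ.coxSystem.simple_injective (mul_right_cancel hu))
  have hconj : ∀ j : ℕ, (Γ.coxSystem.simple u * Γ.coxSystem.simple v) ^ j
      = w * (Γ.coxSystem.simple k * Γ.coxSystem.simple l) ^ j * w⁻¹ := by
    intro j
    rw [← conj_pow, ← mul_assoc w, ← hu, mul_assoc _ w, ← hv]
    congr 1
    group
  have hM : Γ.coxMatrix u v = n := coxMatrix_eq huv hn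
  have h1 : Γ.coxMatrix k l ∣ n := by
    apply Γ.coxSystem.dvd_of_simple_mul_simple_pow_eq_one
    have := hconj n
    rw [Γ.altProd_simple_comm _ huv hn] at this
    simpa using this.symm
  have h2 : n ∣ Γ.coxMatrix k l := by
    rw [← hM]
    apply Γ.coxSystem.dvd_of_simple_mul_simple_pow_eq_one
    rw [hconj, simple_mul_simple_pow]
    simp
  have hn0 : n ≠ 0 := by
    rintro rfl
    have := Γ.two_le u v huv
    rw [hn] at this
    exact absurd this (by decide)
  have h3 : Γ.m k l = n := (coxMatrix_eq_iff hkl hn0).mp (Nat.dvd_antisymm h1 h2)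
  exact (Γ.induce K).altProd_σ_comm (fun h => hkl (congrArg _ h)) h3

open scoped Classical in
/-- The effect of a word on a coset representative, when the only generator that can be pushed
across is the conjugate `p`, contributing `c`. -/
theorem prod_repPerm_apply {J : Set V} {w₀ p : Γ.CoxeterGroupOf} {c : (Γ.induce K).ArtinGroup}
    (H : ∀ y ∈ Γ.coxSystem.parabolic J, ∀ q ∈ J, y * w₀ ∈ Γ.coxSystem.minReps K →
      (y⁻¹ * Γ.coxSystem.simple q * y = p ∧
        ∃ k : K, Γ.coxSystem.simple q * (y * w₀) = y * w₀ * Γ.coxSystem.simple k ∧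
          (Γ.induce K).σ k = c) ∨
      (y⁻¹ * Γ.coxSystem.simple q * y ≠ p ∧
        Γ.coxSystem.simple q * (y * w₀) ∈ Γ.coxSystem.minReps K))
    (ω : List V) (hω : ∀ q ∈ ω, q ∈ J) {y : Γ.CoxeterGroupOf} (hy : y ∈ Γ.coxSystem.parabolic J)
    (hyw : y * w₀ ∈ Γ.coxSystem.minReps K) (a : (Γ.induce K).ArtinGroup) :
    ∃ z ∈ Γ.coxSystem.parabolic J, ∃ hzw : z * w₀ ∈ Γ.coxSystem.minReps K,
      z * p * z⁻¹ = Γ.coxSystem.wordProd ω * (y * p * y⁻¹) * (Γ.coxSystem.wordProd ω)⁻¹ ∧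
      (Γ.coxSystem.wordProd ω * (y * w₀))⁻¹ * (z * w₀) ∈ Γ.coxSystem.parabolic K ∧
      (ω.map (Γ.repPerm K)).prod (⟨_, hyw⟩, a) =
        (⟨_, hzw⟩, c ^ (Γ.coxSystem.rightInvSeq ω).count (y * p * y⁻¹) * a) := by
  induction ω with
  | nil => exact ⟨y, hy, hyw, by simp, by simp, by simp⟩
  | cons q ω ih =>
    obtain ⟨z, hz, hzw, e1, e2, e3⟩ := ih fun q hq => hω q (List.mem_cons_of_mem _ hq)
    have hq := hω q (by simp)
    have hiff : (Γ.coxSystem.wordProd ω)⁻¹ * Γ.coxSystem.simple q * Γ.coxSystem.wordProd ω =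
        y * p * y⁻¹ ↔ z⁻¹ * Γ.coxSystem.simple q * z = p := by
      constructor
      · intro h
        rw [← h] at e1
        have : z * p * z⁻¹ = Γ.coxSystem.simple q := by rw [e1]; group
        rw [← this]; group
      · intro h
        rw [← h] at e1
        have : Γ.coxSystem.wordProd ω * (y * p * y⁻¹) * (Γ.coxSystem.wordProd ω)⁻¹
          = Γ.coxSystem.simple q := by rw [← h, ← e1]; group
        rw [← this]; group
    simp only [List.map_cons, List.prod_cons, Equiv.Perm.mul_apply, e3, rightInvSeq,
      List.count_cons, beq_iff_eq, hiff, wordProd_cons]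
    rcases H z hz q hq hzw with ⟨h1, k, h2, h3⟩ | ⟨h1, h2⟩
    · have hzp : z * p * z⁻¹ = Γ.coxSystem.simple q := by rw [← h1]; group
      refine ⟨z, hz, hzw, ?_, ?_, ?_⟩
      · have h : Γ.coxSystem.simple q * (Γ.coxSystem.wordProd ω * (y * p * y⁻¹) *
            (Γ.coxSystem.wordProd ω)⁻¹) * Γ.coxSystem.simple q = Γ.coxSystem.simple q := by
          rw [← e1, hzp]
          simp
        refine hzp.trans (h.symm.trans ?_)
        simp only [mul_inv_rev, inv_simple, mul_assoc]
      · have : z * w₀ = Γ.coxSystem.simple q * (z * w₀) * (Γ.coxSystem.simple k)⁻¹ := by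
          rw [h2]; group
        rw [this]
        have e : (Γ.coxSystem.simple q * Γ.coxSystem.wordProd ω * (y * w₀))⁻¹ *
          (Γ.coxSystem.simple q * (z * w₀) * (Γ.coxSystem.simple k)⁻¹) =
          (Γ.coxSystem.wordProd ω * (y * w₀))⁻¹ * (z * w₀) * (Γ.coxSystem.simple k)⁻¹ := by
          group
        rw [e]
        exact mul_mem e2 (inv_mem (Γ.coxSystem.simple_mem_parabolic k.2))
      · rw [repPerm_of_eq _ h2, if_pos h1, h3, pow_succ', mul_assoc c]
    · refine ⟨Γ.coxSystem.simple q * z, mul_mem (Γ.coxSystem.simple_mem_parabolic hq) hz,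
        by rwa [mul_assoc], ?_, ?_, ?_⟩
      · have : Γ.coxSystem.simple q * z * p * (Γ.coxSystem.simple q * z)⁻¹ =
          Γ.coxSystem.simple q * (z * p * z⁻¹) * (Γ.coxSystem.simple q)⁻¹ := by group
        rw [this, e1]
        group
      · convert e2 using 1
        group
      · rw [repPerm_of_mem _ h2, if_neg h1, add_zero]
        simp only [mul_assoc]

theorem altProd_repPerm_comm {u v : V} {n : ℕ} (huv : u ≠ v) (hn : Γ.m u v = n) :
    altProd (Γ.repPerm K u) (Γ.repPerm K v) n = altProd (Γ.repPerm K v) (Γ.repPerm K u) n := by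
  classical
  rw [← prod_map_altList, ← prod_map_altList]
  ext1 ⟨⟨w, hw⟩, a⟩
  set cs := Γ.coxSystem
  obtain ⟨d, hd, y, hy, e⟩ := cs.exists_eq_mul_of_minReps ({u, v} : Set V) w⁻¹
  obtain ⟨w₀, rfl⟩ : ∃ w₀, d = w₀⁻¹ := ⟨d⁻¹, by simp⟩
  obtain ⟨x, rfl⟩ : ∃ x, y = x⁻¹ := ⟨y⁻¹, by simp⟩
  rw [inv_mem_iff] at hy
  obtain rfl : w = x * w₀ := by rw [← inv_inj, e, mul_inv_rev]
  have hlen : ∀ y ∈ cs.parabolic ({u, v} : Set V),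
      cs.length (y * w₀) = cs.length y + cs.length w₀ := by
    intro y hy
    have := cs.length_mul_of_mem_minReps hd (inv_mem hy)
    rw [← mul_inv_rev] at this
    simp only [length_inv] at this
    omega
  have hw₀ : w₀ ∈ cs.minReps K := by
    intro k hk hdesc
    have h1 := hw k hk
    rw [not_isRightDescent_iff, hlen x hy] at h1
    rw [isRightDescent_iff] at hdesc
    have := cs.length_mul_le x (w₀ * cs.simple k)
    rw [← mul_assoc] at this
    omega
  have hpush : ∀ y ∈ cs.parabolic ({u, v} : Set V), ∀ q ∈ ({u, v} : Set V), ∀ k : K,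
      cs.simple q * (y * w₀) = y * w₀ * cs.simple k →
      ∃ j ∈ ({u, v} : Set V), y⁻¹ * cs.simple q * y = cs.simple j ∧
        cs.simple j * w₀ = w₀ * cs.simple k := by
    intro y hy q hq k h
    have hp : y⁻¹ * cs.simple q * y ∈ cs.parabolic ({u, v} : Set V) :=
      mul_mem (mul_mem (inv_mem hy) (cs.simple_mem_parabolic hq)) hy
    have h1 : y⁻¹ * cs.simple q * y * w₀ = w₀ * cs.simple k := by
      rw [mul_assoc, mul_assoc, h]
      group
    have h2 := hlen _ hp
    have h3 := hw₀ k k.2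
    rw [not_isRightDescent_iff] at h3
    rw [h1, h3] at h2
    obtain ⟨j, hj, e⟩ := cs.exists_simple_of_mem_parabolic hp (by omega)
    exact ⟨j, hj, e, by rw [← e, h1]⟩
  by_cases hboth : (∃ k : K, cs.simple u * w₀ = w₀ * cs.simple k) ∧
      ∃ l : K, cs.simple v * w₀ = w₀ * cs.simple l
  · obtain ⟨⟨k, hk⟩, l, hl⟩ := hboth
    have hmem : ∀ y ∈ cs.parabolic ({u, v} : Set V), w₀⁻¹ * y * w₀ ∈ cs.parabolic K := by
      intro y hy
      induction hy using Subgroup.closure_induction with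
      | mem y hy =>
        obtain ⟨j, rfl | rfl, rfl⟩ := hy
        · rw [mul_assoc, hk, inv_mul_cancel_left]
          exact cs.simple_mem_parabolic k.2
        · rw [mul_assoc, hl, inv_mul_cancel_left]
          exact cs.simple_mem_parabolic l.2
      | one => simp
      | mul y z _ _ hy hz =>
        have : w₀⁻¹ * (y * z) * w₀ = (w₀⁻¹ * y * w₀) * (w₀⁻¹ * z * w₀) := by group
        rw [this]
        exact mul_mem hy hz
      | inv y _ hy =>
        have : w₀⁻¹ * y⁻¹ * w₀ = (w₀⁻¹ * y * w₀)⁻¹ := by group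
        rw [this]
        exact inv_mem hy
    have hxw : (⟨x * w₀, hw⟩ : cs.minReps K) = ⟨w₀, hw₀⟩ := by
      refine Subtype.ext (cs.eq_of_mem_minReps hw₀ hw ?_).symm
      rw [← mul_assoc]
      exact hmem x hy
    rw [hxw, repPerm_altList_apply (w := ⟨w₀, hw₀⟩) hk hl,
      repPerm_altList_apply (w := ⟨w₀, hw₀⟩) hl hk, altProd_σ_comm_of_conj huv hn hk hl]
  · obtain ⟨p, c, hpc, hp⟩ : ∃ (p : Γ.CoxeterGroupOf) (c : (Γ.induce K).ArtinGroup),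
        (∀ j ∈ ({u, v} : Set V), ∀ k : K, cs.simple j * w₀ = w₀ * cs.simple k →
          cs.simple j = p ∧ (Γ.induce K).σ k = c) ∧
        (p = 1 ∨ ∃ k : K, p * w₀ = w₀ * cs.simple k ∧ (Γ.induce K).σ k = c) := by
      have huniq : ∀ k l : K, w₀ * cs.simple k = w₀ * cs.simple l → l = k := fun k l h =>
        Subtype.ext (cs.simple_injective (mul_left_cancel h)).symm
      by_cases hu : ∃ k : K, cs.simple u * w₀ = w₀ * cs.simple k
      · obtain ⟨k, hk⟩ := hu
        refine ⟨cs.simple u, (Γ.induce K).σ k, ?_, Or.inr ⟨k, hk, rfl⟩⟩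
        rintro j (rfl | rfl) l hl
        · exact ⟨rfl, by rw [huniq k l (hk.symm.trans hl)]⟩
        · exact absurd ⟨⟨k, hk⟩, l, hl⟩ hboth
      · by_cases hv : ∃ k : K, cs.simple v * w₀ = w₀ * cs.simple k
        · obtain ⟨k, hk⟩ := hv
          refine ⟨cs.simple v, (Γ.induce K).σ k, ?_, Or.inr ⟨k, hk, rfl⟩⟩
          rintro j (rfl | rfl) l hl
          · exact absurd ⟨l, hl⟩ hu
          · exact ⟨rfl, by rw [huniq k l (hk.symm.trans hl)]⟩
        · refine ⟨1, 1, ?_, Or.inl rfl⟩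
          rintro j (rfl | rfl) l hl
          · exact absurd ⟨l, hl⟩ hu
          · exact absurd ⟨l, hl⟩ hv
    have H : ∀ y ∈ cs.parabolic ({u, v} : Set V), ∀ q ∈ ({u, v} : Set V),
        y * w₀ ∈ cs.minReps K →
        (y⁻¹ * cs.simple q * y = p ∧
          ∃ k : K, cs.simple q * (y * w₀) = y * w₀ * cs.simple k ∧ (Γ.induce K).σ k = c) ∨
        (y⁻¹ * cs.simple q * y ≠ p ∧ cs.simple q * (y * w₀) ∈ cs.minReps K) := by
      intro y hy q hq hyw
      by_cases h : y⁻¹ * cs.simple q * y = p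
      · refine Or.inl ⟨h, ?_⟩
        rcases hp with rfl | ⟨k, hk, hc⟩
        · exfalso
          have : cs.simple q = 1 := by
            calc cs.simple q = y * (y⁻¹ * cs.simple q * y) * y⁻¹ := by group
              _ = 1 := by rw [h]; group
          simpa [this] using cs.length_simple q
        · refine ⟨k, ?_, hc⟩
          rw [mul_assoc, ← hk, ← h]
          group
      · refine Or.inr ⟨h, ?_⟩
        by_contra hn
        obtain ⟨k, hk⟩ := Γ.exists_pushed K (w := ⟨_, hyw⟩) hn
        obtain ⟨j, hj, e1, e2⟩ := hpush y hy q hq k hk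
        exact h (e1.trans (hpc j hj k e2).1)
    have hpow := Γ.altProd_simple_comm cs huv hn
    obtain ⟨z, _, hzw, _, hz, ez⟩ := prod_repPerm_apply H (altList u v n)
      (fun q hq => mem_altList hq) hy hw a
    obtain ⟨z', _, hzw', _, hz', ez'⟩ := prod_repPerm_apply H (altList v u n)
      (fun q hq => (mem_altList hq).symm) hy hw a
    rw [ez, ez', (cs.rightInvSeq_altList_perm hpow).count_eq]
    congr 1
    refine Subtype.ext (cs.eq_of_mem_minReps hzw hzw' ?_)
    rw [← Γ.coxSystem.wordProd_altList_comm hpow] at hz'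
    have := mul_mem (inv_mem hz) hz'
    convert this using 1
    group

variable (Γ K)

/-- The action of the Artin group of `Γ` on the product of the set of minimal representatives of
the cosets of `W_K` with the Artin group of `Γ_K`. -/
noncomputable def repHom :
    Γ.ArtinGroup →* Equiv.Perm (Γ.coxSystem.minReps K × (Γ.induce K).ArtinGroup) :=
  Γ.artinLift (Γ.repPerm K) fun _ _ _ huv hk => altProd_repPerm_comm huv hk

theorem one_mem_minReps : (1 : Γ.CoxeterGroupOf) ∈ Γ.coxSystem.minReps K :=
  fun k _ => Γ.coxSystem.not_isRightDescent_one k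

theorem inclHom_σ (k : K) : Γ.inclHom K ((Γ.induce K).σ k) = Γ.σ k := mapHom_σ _ _ _ _ _ _

theorem induceHom_σ {K' : Set V} (h : K' ⊆ K) (k : K') :
    Γ.induceHom h ((Γ.induce K').σ k) = (Γ.induce K).σ ⟨k, h k.2⟩ := mapHom_σ _ _ _ _ _ _

theorem inclHom_induceHom {K' : Set V} (h : K' ⊆ K) (g : (Γ.induce K').ArtinGroup) :
    Γ.inclHom K (Γ.induceHom h g) = Γ.inclHom K' g := by
  have : (Γ.inclHom K).comp (Γ.induceHom h) = Γ.inclHom K' :=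
    artinHom_ext fun v => by
      rw [MonoidHom.comp_apply, induceHom_σ, inclHom_σ, inclHom_σ]
  exact DFunLike.congr_fun this g

theorem repHom_inclHom_apply (g a : (Γ.induce K).ArtinGroup) :
    Γ.repHom K (Γ.inclHom K g) (⟨1, Γ.one_mem_minReps K⟩, a) =
      (⟨1, Γ.one_mem_minReps K⟩, g * a) := by
  have hg : g ∈ Subgroup.closure (Set.range (Γ.induce K).σ) := by
    rw [closure_range_σ]
    trivial
  induction hg using Subgroup.closure_induction generalizing a with
  | mem x hx =>
    obtain ⟨k, rfl⟩ := hx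
    rw [inclHom_σ, repHom, artinLift_σ]
    exact repPerm_of_eq a (by simp)
  | one => simp
  | mul x y _ _ hx hy => rw [map_mul, map_mul, Equiv.Perm.mul_apply, hy, hx, mul_assoc]
  | inv x _ hx => rw [map_inv, map_inv, Equiv.Perm.inv_eq_iff_eq, hx, mul_inv_cancel_left]

/-- Special subgroups of Artin groups are Artin groups (van der Lek). -/
theorem inclHom_injective : Function.Injective (Γ.inclHom K) := by
  intro g h e
  have h1 := Γ.repHom_inclHom_apply K g 1
  rw [e, repHom_inclHom_apply, mul_one, mul_one] at h1
  exact (Prod.ext_iff.mp h1).2.symm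

/-- Special subgroups intersect in special subgroups (van der Lek). -/
theorem range_inclHom_inf (X K : Set V) :
    (Γ.inclHom X).range ⊓ (Γ.inclHom K).range ≤ (Γ.inclHom (X ∩ K)).range := by
  rintro _ ⟨⟨x, rfl⟩, ⟨g, e⟩⟩
  set S : Set (Γ.coxSystem.minReps K × (Γ.induce K).ArtinGroup) :=
    {p | (p.1 : Γ.CoxeterGroupOf) ∈ Γ.coxSystem.parabolic X ∧
      p.2 ∈ (Γ.induceHom (Set.inter_subset_right : X ∩ K ⊆ K)).range}
  have hgen : ∀ v ∈ X, ∀ p, Γ.repPerm K v p ∈ S ↔ p ∈ S := by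
    rintro v hv ⟨⟨w, hw⟩, a⟩
    have hvX := Γ.coxSystem.simple_mem_parabolic hv
    rcases Γ.coxSystem.mem_or_exists_of_mem_minReps v hw with h | ⟨k, hk, h⟩
    · rw [repPerm_of_mem (w := ⟨w, hw⟩) _ h]
      exact and_congr_left' (Subgroup.mul_mem_cancel_left _ hvX)
    · rw [repPerm_of_eq (w := ⟨w, hw⟩) (k := ⟨k, hk⟩) _ h]
      refine and_congr_right fun hwX => Subgroup.mul_mem_cancel_left _ ?_
      have hkX : k ∈ X := by
        apply Γ.coxSystem.mem_of_simple_mem_parabolic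
        rw [eq_inv_mul_of_mul_eq h.symm]
        exact mul_mem (inv_mem hwX) (mul_mem hvX hwX)
      exact ⟨(Γ.induce (X ∩ K)).σ ⟨k, hkX, hk⟩, Γ.induceHom_σ K _ _⟩
  have hx : ∀ p, Γ.repHom K (Γ.inclHom X x) p ∈ S ↔ p ∈ S := by
    have hx : x ∈ Subgroup.closure (Set.range (Γ.induce X).σ) := by
      rw [closure_range_σ]
      trivial
    clear e
    induction hx using Subgroup.closure_induction with
    | mem x hx =>
      obtain ⟨k, rfl⟩ := hx
      rw [inclHom_σ, repHom, artinLift_σ]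
      exact hgen k k.2
    | one => simp
    | mul x y _ _ hx hy =>
      intro p
      rw [map_mul, map_mul, Equiv.Perm.mul_apply, hx, hy]
    | inv x _ hx =>
      intro p
      rw [map_inv, map_inv, ← hx, Equiv.Perm.inv_def, Equiv.apply_symm_apply]
  have h1 : (⟨⟨1, Γ.one_mem_minReps K⟩, 1⟩ :
      Γ.coxSystem.minReps K × (Γ.induce K).ArtinGroup) ∈ S := ⟨one_mem _, one_mem _⟩
  rw [← hx, ← e, repHom_inclHom_apply] at h1
  obtain ⟨y, hy⟩ := h1.2
  refine ⟨y, ?_⟩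
  rw [← e, ← Γ.inclHom_induceHom K Set.inter_subset_right, hy, mul_one]

end LabelledGraph

namespace CoxeterSystem

variable {B W : Type*} [Group W] {M : CoxeterMatrix B} (cs : CoxeterSystem M W)

theorem IsReduced.eq_altList {cs : CoxeterSystem M W} {u v : B} {ω : List B}
    (hr : cs.IsReduced ω) (hω : ∀ i ∈ ω, i = u ∨ i = v) :
    ω = altList u v ω.length ∨ ω = altList v u ω.length := by
  induction ω with
  | nil => exact Or.inl rfl
  | cons i ω ih =>
    have hr' : cs.IsReduced ω := by simpa using hr.drop 1
    have hne : ∀ η, ω ≠ i :: η := by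
      rintro η rfl
      have h1 := hr.eq
      have h2 := cs.length_wordProd_le η
      rw [wordProd_cons, wordProd_cons, simple_mul_simple_cancel_left] at h1
      simp only [List.length_cons] at h1
      omega
    rcases ω with _ | ⟨j, ω⟩
    · rcases hω i (by simp) with rfl | rfl
      exacts [Or.inl rfl, Or.inr rfl]
    rcases ih hr' fun j hj => hω j (List.mem_cons_of_mem _ hj) with h | h
    · have hju : j = u := (List.cons.inj h).1
      have hi := (hω i (by simp)).resolve_left fun e => hne ω (by rw [e, hju])
      exact Or.inr (congrArg₂ List.cons hi h)
    · have hjv : j = v := (List.cons.inj h).1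
      have hi := (hω i (by simp)).resolve_right fun e => hne ω (by rw [e, hjv])
      exact Or.inl (congrArg₂ List.cons hi h)

theorem le_of_isReduced_altList {u v : B} {n : ℕ} (h : cs.IsReduced (altList u v n))
    (hM : M u v ≠ 0) : n ≤ M u v := by
  by_contra hlt
  have hnd := h.nodup_leftInvSeq
  rw [leftInvSeq_altList] at hnd
  have := List.inj_on_of_nodup_map hnd (List.mem_range.mpr (by omega : 0 < n))
    (List.mem_range.mpr (by omega : M u v < n)) (by simp)
  exact hM this.symm

theorem exists_isReduced_cons {w : W} {i : B} (h : cs.IsLeftDescent w i) :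
    ∃ ω, cs.IsReduced (i :: ω) ∧ cs.wordProd (i :: ω) = w := by
  obtain ⟨ω, hr, e⟩ := cs.exists_isReduced (cs.simple i * w)
  have e' : cs.wordProd (i :: ω) = w := by rw [wordProd_cons, ← e]; simp
  refine ⟨ω, ?_, e'⟩
  rw [isLeftDescent_iff] at h
  rw [IsReduced, e', ← h, e, hr.eq, List.length_cons]

theorem exists_eq_mul_of_forall_isRightDescent {x : W} (hx : ∀ i, cs.IsRightDescent x i)
    (w : W) : ∃ y, x = y * w ∧ cs.length x = cs.length y + cs.length w := by
  obtain ⟨ω, hr, rfl⟩ := cs.exists_isReduced w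
  induction ω using List.reverseRecOn with
  | nil => exact ⟨x, by simp, by simp⟩
  | append_singleton ω i ih =>
    have hr' : cs.IsReduced ω := by
      have := hr.take ω.length
      simpa using this
    obtain ⟨y, hy, hl⟩ := ih hr'
    obtain ⟨α, hα, rfl⟩ := cs.exists_isReduced y
    rw [← wordProd_append] at hy
    have hd := hx i
    rw [hy] at hd
    obtain ⟨a, k, b, h1, h2⟩ := cs.exists_split_of_isRightDescent _ hd
    have case1 : ∀ c d, ω = c ++ k :: d → cs.wordProd (α ++ ω) * cs.simple i =
        cs.wordProd (α ++ (c ++ d)) → False := by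
      rintro c d rfl h2
      rw [cs.wordProd_append α, cs.wordProd_append α, mul_assoc] at h2
      have h3 := mul_left_cancel h2
      have := cs.length_wordProd_le (c ++ d)
      rw [← h3, ← wordProd_concat, List.concat_eq_append, hr.eq] at this
      simp at this
    rw [List.append_eq_append_iff] at h1
    rcases h1 with ⟨c, rfl, h1⟩ | ⟨c, h0, h1⟩
    · exact (case1 c b h1 (by simpa using h2)).elim
    · rcases c with _ | ⟨k', c⟩
      · exact (case1 [] b (by simpa using h1.symm) (by simpa [h0] using h2)).elim
      · simp only [List.cons_append, List.cons.injEq] at h1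
        obtain ⟨rfl, rfl⟩ := h1
        have e : x = cs.wordProd (a ++ c) * cs.wordProd (ω ++ [i]) := by
          rw [wordProd_append _ ω, wordProd_singleton, ← mul_assoc, ← wordProd_append,
            List.append_assoc, ← h2, ← hy]
          simp
        refine ⟨_, e, le_antisymm ?_ ?_⟩
        · rw [e]
          exact cs.length_mul_le _ _
        · have h3 := cs.length_wordProd_le (a ++ c)
          rw [hl, hα.eq, hr'.eq, hr.eq, h0]
          simp only [List.length_append, List.length_cons, List.length_nil] at h3 ⊢
          omega

theorem exists_longest [Finite W] : ∃ w₀ : W, w₀ * w₀ = 1 ∧ (∀ i, cs.IsRightDescent w₀ i) ∧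
    ∀ i, ∃ j, cs.simple i * w₀ = w₀ * cs.simple j := by
  obtain ⟨w₀, hmax⟩ := Finite.exists_max cs.length
  have hd : ∀ i, cs.IsRightDescent w₀ i := fun i => by
    by_contra h
    rw [not_isRightDescent_iff] at h
    have := hmax (w₀ * cs.simple i)
    omega
  have hinv : w₀⁻¹ = w₀ := by
    obtain ⟨y, e, hl⟩ := cs.exists_eq_mul_of_forall_isRightDescent hd w₀⁻¹
    rw [length_inv] at hl
    have h0 : cs.length y = 0 := by omega
    rw [length_eq_zero_iff] at h0
    rw [h0, one_mul] at e
    exact e.symm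
  have hsq : w₀ * w₀ = 1 := by
    nth_rewrite 1 [← hinv]
    simp
  have hlen : ∀ v, cs.length w₀ = cs.length (w₀ * v) + cs.length v := by
    intro v
    obtain ⟨y, e, hl⟩ := cs.exists_eq_mul_of_forall_isRightDescent hd v⁻¹
    have e' : w₀ * v = y := by rw [e, inv_mul_cancel_right]
    rwa [e', ← cs.length_inv v]
  refine ⟨w₀, hsq, hd, fun i => ?_⟩
  have h1 : cs.length (w₀ * (cs.simple i * w₀)) = 1 := by
    have h2 := hlen (cs.simple i * w₀)
    have h3 := hlen (cs.simple i)
    have h4 : cs.length (cs.simple i * w₀) = cs.length (w₀ * cs.simple i) := by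
      rw [← length_inv, mul_inv_rev, hinv, inv_simple]
    rw [length_simple] at h3
    omega
  obtain ⟨j, e⟩ := cs.length_eq_one_iff.mp h1
  exact ⟨j, by rw [← e, ← mul_assoc, hsq, one_mul]⟩

end CoxeterSystem

namespace LabelledGraph

open CoxeterSystem

variable {V : Type*} (Γ : LabelledGraph V)

variable {Γ} in
/-- Matsumoto's theorem. -/
theorem artinWord_eq_of_isReduced {ω η : List V} (hω : Γ.coxSystem.IsReduced ω)
    (hη : Γ.coxSystem.IsReduced η) (h : Γ.coxSystem.wordProd ω = Γ.coxSystem.wordProd η) :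
    Γ.artinWord ω = Γ.artinWord η := by
  induction hn : ω.length using Nat.strong_induction_on generalizing ω η with
  | _ n ih =>
  subst hn
  have hlen : ω.length = η.length := by rw [← hω.eq, h, hη.eq]
  rcases ω with _ | ⟨u, ω⟩
  · rw [List.length_eq_zero_iff.mp hlen.symm]
  rcases η with _ | ⟨v, η⟩
  · simp at hlen
  have hω' : Γ.coxSystem.IsReduced ω := by simpa using hω.drop 1
  have hη' : Γ.coxSystem.IsReduced η := by simpa using hη.drop 1
  have key : ∀ {u : V} {ω η : List V}, Γ.coxSystem.IsReduced (u :: ω) →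
      Γ.coxSystem.IsReduced (u :: η) → ω.length + 1 = (u :: η).length →
      Γ.coxSystem.wordProd (u :: ω) = Γ.coxSystem.wordProd (u :: η) →
      (∀ {ω' η' : List V}, Γ.coxSystem.IsReduced ω' → Γ.coxSystem.IsReduced η' →
        Γ.coxSystem.wordProd ω' = Γ.coxSystem.wordProd η' → ω'.length = ω.length →
        Γ.artinWord ω' = Γ.artinWord η') →
      Γ.artinWord (u :: ω) = Γ.artinWord (u :: η) := by
    intro u ω η hω hη _ h ih
    rw [wordProd_cons, wordProd_cons] at h
    rw [artinWord_cons, artinWord_cons, ih (by simpa using hω.drop 1) (by simpa using hη.drop 1)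
      (mul_left_cancel h) rfl]
  have ih' : ∀ {ω' η' : List V}, Γ.coxSystem.IsReduced ω' → Γ.coxSystem.IsReduced η' →
        Γ.coxSystem.wordProd ω' = Γ.coxSystem.wordProd η' → ω'.length = ω.length →
        Γ.artinWord ω' = Γ.artinWord η' := fun h1 h2 h3 h4 =>
    ih _ (by simp [h4]) h1 h2 h3 rfl
  have ih'' : ∀ {ω' η' : List V}, Γ.coxSystem.IsReduced ω' → Γ.coxSystem.IsReduced η' →
        Γ.coxSystem.wordProd ω' = Γ.coxSystem.wordProd η' → ω'.length = η.length →
        Γ.artinWord ω' = Γ.artinWord η' := fun h1 h2 h3 h4 =>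
    ih' h1 h2 h3 (by simp at hlen; omega)
  rcases eq_or_ne u v with rfl | huv
  · exact key hω hη hlen h ih'
  set cs := Γ.coxSystem
  set w := cs.wordProd (u :: ω) with hw
  have hdu : cs.IsLeftDescent w u := by
    rw [IsLeftDescent, hw, hω.eq, wordProd_cons, simple_mul_simple_cancel_left, hω'.eq]
    simp
  have hdv : cs.IsLeftDescent w v := by
    rw [IsLeftDescent, h, hη.eq, wordProd_cons, simple_mul_simple_cancel_left, hη'.eq]
    simp
  obtain ⟨d, hd, y, hy, e⟩ := cs.exists_eq_mul_of_minReps ({u, v} : Set V) w⁻¹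
  obtain ⟨w₀, rfl⟩ : ∃ w₀, d = w₀⁻¹ := ⟨d⁻¹, by simp⟩
  obtain ⟨x, rfl⟩ : ∃ x, y = x⁻¹ := ⟨y⁻¹, by simp⟩
  rw [inv_mem_iff] at hy
  have hwx : w = x * w₀ := by rw [← inv_inj, e, mul_inv_rev]
  have hlen' : ∀ y ∈ cs.parabolic ({u, v} : Set V),
      cs.length (y * w₀) = cs.length y + cs.length w₀ := by
    intro y hy
    have := cs.length_mul_of_mem_minReps hd (inv_mem hy)
    rw [← mul_inv_rev] at this
    simp only [length_inv] at this
    omega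
  have hdx : ∀ q ∈ ({u, v} : Set V), cs.IsLeftDescent w q → ∃ ξ : List V,
      cs.IsReduced (q :: ξ) ∧ cs.wordProd (q :: ξ) = x ∧ ∀ i ∈ ξ, i ∈ ({u, v} : Set V) := by
    intro q hq hdq
    have hqm := cs.simple_mem_parabolic hq
    rw [IsLeftDescent, hwx, ← mul_assoc, hlen' x hy, hlen' _ (mul_mem hqm hy)] at hdq
    have hdq' : cs.IsLeftDescent x q := by
      rw [IsLeftDescent]; omega
    obtain ⟨ξ, hξ, hr, e⟩ := cs.exists_isReduced_of_mem_parabolic (mul_mem hqm hy)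
    have e' : cs.wordProd (q :: ξ) = x := by
      rw [wordProd_cons, e, simple_mul_simple_cancel_left]
    refine ⟨ξ, ?_, e', hξ⟩
    rw [isLeftDescent_iff] at hdq'
    rw [CoxeterSystem.IsReduced, e', ← hdq', ← e, hr.eq, List.length_cons]
  obtain ⟨ξ, hξ, exu, hξm⟩ := hdx u (by simp) hdu
  obtain ⟨ζ, hζ, exv, hζm⟩ := hdx v (by simp) hdv
  have hξa : u :: ξ = altList u v (u :: ξ).length := by
    refine (hξ.eq_altList (u := u) (v := v) ?_).resolve_right fun h => huv ?_
    · intro i hi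
      rcases List.mem_cons.mp hi with rfl | hi
      · exact Or.inl rfl
      · exact hξm i hi
    · exact (List.cons.inj h).1
  have hζa : v :: ζ = altList v u (v :: ζ).length := by
    refine (hζ.eq_altList (u := v) (v := u) ?_).resolve_right fun h => huv ?_
    · intro i hi
      rcases List.mem_cons.mp hi with rfl | hi
      · exact Or.inl rfl
      · exact (hζm i hi).symm
    · exact (List.cons.inj h).1.symm
  have hl : (v :: ζ).length = (u :: ξ).length := by rw [← hξ.eq, ← hζ.eq, exu, exv]
  rw [hl] at hζa
  set n := (u :: ξ).length with hn
  have hpow : (cs.simple u * cs.simple v) ^ n = 1 := by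
    rw [← altProd_mul_inv_altProd (cs.simple_mul_simple_self u) (cs.simple_mul_simple_self v),
      ← wordProd_altList, ← wordProd_altList, ← hξa, ← hζa, exu, exv, mul_inv_cancel]
  have hdvd := cs.dvd_of_simple_mul_simple_pow_eq_one hpow
  have hn0 : n ≠ 0 := by simp [hn]
  have hM0 : Γ.coxMatrix u v ≠ 0 := fun h => by
    rw [h] at hdvd
    exact hn0 (Nat.eq_zero_of_zero_dvd hdvd)
  have hM : Γ.coxMatrix u v = n :=
    le_antisymm (Nat.le_of_dvd (Nat.pos_of_ne_zero hn0) hdvd)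
      (cs.le_of_isReduced_altList (hξa ▸ hξ) hM0)
  have hbraid := Γ.artinWord_altList_comm huv ((coxMatrix_eq_iff huv hn0).mp hM)
  rw [← hξa, ← hζa] at hbraid
  obtain ⟨θ, hθ, rfl⟩ := cs.exists_isReduced w₀
  have hred : ∀ {q ξ}, cs.IsReduced (q :: ξ) → cs.wordProd (q :: ξ) = x →
      cs.IsReduced (q :: (ξ ++ θ)) ∧ cs.wordProd (q :: (ξ ++ θ)) = w := by
    intro q ξ h1 h2
    have e : cs.wordProd (q :: (ξ ++ θ)) = w := by
      rw [← List.cons_append, wordProd_append, h2, hwx]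
    refine ⟨?_, e⟩
    rw [CoxeterSystem.IsReduced, e, hwx, hlen' x hy, ← h2, h1.eq, hθ.eq, ← List.cons_append, List.length_append]
  obtain ⟨r1, p1⟩ := hred hξ exu
  obtain ⟨r2, p2⟩ := hred hζ exv
  rw [key hω r1 (by rw [← r1.eq, p1, hw, hω.eq]; rfl) (hw.symm.trans p1.symm) ih',
    key hη r2 (by rw [← r2.eq, p2, h, hη.eq]; rfl) (h.symm.trans p2.symm) ih'',
    ← List.cons_append, ← List.cons_append, artinWord_append, artinWord_append, hbraid]

/-- The properties of the half twist of a spherical Artin group. -/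
theorem Spherical.exists_halfTwist {Γ : LabelledGraph V} (h : Γ.Spherical) :
    ∃ ω : List V, Γ.coxSystem.wordProd ω * Γ.coxSystem.wordProd ω = 1 ∧
      (∀ v, Commute (Γ.artinWord (ω ++ ω)) (Γ.σ v)) ∧
      ∀ t, ∃ η : List V, Γ.artinWord (η.concat t) = Γ.artinWord ω := by
  have : Finite Γ.CoxeterGroupOf := h
  obtain ⟨w₀, hsq, hd, hj⟩ := Γ.coxSystem.exists_longest
  obtain ⟨ω, hr, rfl⟩ := Γ.coxSystem.exists_isReduced w₀
  set cs := Γ.coxSystem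
  have hinv : (cs.wordProd ω)⁻¹ = cs.wordProd ω := inv_eq_of_mul_eq_one_left hsq
  have hend : ∀ t, ∃ η : List V, cs.IsReduced (η.concat t) ∧
      cs.wordProd (η.concat t) = cs.wordProd ω := by
    intro t
    have h1 := hd t
    rw [← isLeftDescent_inv_iff] at h1
    obtain ⟨η, hη, e⟩ := cs.exists_isReduced_cons h1
    refine ⟨η.reverse, ?_, ?_⟩
    · rw [← isReduced_reverse_iff]
      simpa using hη
    · rw [← inv_inj, ← wordProd_reverse, ← e]
      simp
  have hcomm : ∀ i j, cs.simple i * cs.wordProd ω = cs.wordProd ω * cs.simple j →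
      Γ.σ i * Γ.artinWord ω = Γ.artinWord ω * Γ.σ j := by
    intro i j hij
    obtain ⟨η, hη, e⟩ := hend j
    have e2 : cs.wordProd (i :: η) = cs.wordProd ω := by
      rw [wordProd_cons]
      have : cs.wordProd η = cs.simple i * cs.wordProd ω := by
        rw [hij, ← e, wordProd_concat, simple_mul_simple_cancel_right]
      rw [this, simple_mul_simple_cancel_left]
    have hη2 : cs.IsReduced (i :: η) := by
      rw [CoxeterSystem.IsReduced, e2, ← e, hη.eq]
      simp
    have h1 : Γ.artinWord ω = Γ.σ i * Γ.artinWord η := by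
      rw [artinWord_eq_of_isReduced hr hη2 e2.symm, artinWord_cons]
    have h2 : Γ.artinWord ω = Γ.artinWord η * Γ.σ j := by
      rw [artinWord_eq_of_isReduced hr hη e.symm, List.concat_eq_append, artinWord_append]
      simp [artinWord]
    nth_rewrite 1 [h2]
    rw [← mul_assoc, ← h1]
  refine ⟨ω, hsq, fun v => ?_, fun t => ?_⟩
  · obtain ⟨j, e⟩ := hj v
    have e' : cs.simple j * cs.wordProd ω = cs.wordProd ω * cs.simple v := by
      have : cs.wordProd ω * (cs.simple v * cs.wordProd ω) * cs.wordProd ω =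
          cs.wordProd ω * (cs.wordProd ω * cs.simple j) * cs.wordProd ω := by rw [e]
      rw [← mul_assoc, mul_assoc _ (cs.wordProd ω), hsq, mul_one, ← mul_assoc, hsq, one_mul] at this
      exact this.symm
    symm
    rw [Commute, SemiconjBy, artinWord_append, ← mul_assoc, hcomm v j e, mul_assoc, hcomm j v e',
      mul_assoc]
  · obtain ⟨η, hη, e⟩ := hend t
    exact ⟨η, artinWord_eq_of_isReduced hη hr e⟩

end LabelledGraph

namespace CoxeterSystem

variable {B W : Type*} [Group W] {M : CoxeterMatrix B} (cs : CoxeterSystem M W)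

theorem mem_parabolic_of_mem_rightInvSeq {J : Set B} {ω : List B} (h : ∀ i ∈ ω, i ∈ J) {x : W}
    (hx : x ∈ cs.rightInvSeq ω) : x ∈ cs.parabolic J := by
  induction ω with
  | nil => simp at hx
  | cons i ω ih =>
    have hω := fun j hj => h j (List.mem_cons_of_mem _ hj)
    rw [rightInvSeq, List.mem_cons] at hx
    rcases hx with rfl | hx
    · have h1 := cs.wordProd_mem_parabolic hω
      exact mul_mem (mul_mem (inv_mem h1) (cs.simple_mem_parabolic (h i (by simp)))) h1
    · exact ih hω hx

theorem simple_mem_rightInvSeq_concat (ω : List B) (i : B) :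
    cs.simple i ∈ cs.rightInvSeq (ω.concat i) := by
  rw [rightInvSeq_concat]
  simp

end CoxeterSystem

namespace LabelledGraph

open CoxeterSystem

variable {V : Type*} (Γ : LabelledGraph V)

/-- The action of the Artin group on pairs of an element of the Coxeter group and an integer,
which counts signed crossings of walls. -/
noncomputable def crossAction : Γ.ArtinGroup →* Equiv.Perm (Γ.CoxeterGroupOf × ℤ) :=
  Γ.artinLift (Γ.coxSystem.reflPerm ℤ) fun u v k huv hk => by
    classical
    have h := Γ.altProd_simple_comm Γ.coxSystem huv hk
    ext1 ⟨x, n⟩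
    rw [← prod_map_altList, ← prod_map_altList, prod_reflPerm_apply, prod_reflPerm_apply,
      wordProd_altList_comm _ h, (rightInvSeq_altList_perm _ h).count_eq]

open scoped Classical in
theorem crossAction_artinWord (ω : List V) (x : Γ.CoxeterGroupOf) (n : ℤ) :
    Γ.crossAction (Γ.artinWord ω) (x, n) =
      (Γ.coxSystem.wordProd ω * x * (Γ.coxSystem.wordProd ω)⁻¹,
        n + ((Γ.coxSystem.rightInvSeq ω).count x : ℕ)) := by
  rw [← prod_reflPerm_apply, artinWord, map_list_prod, List.map_map]
  congr 4

theorem crossAction_apply (g : Γ.ArtinGroup) (x : Γ.CoxeterGroupOf) (n : ℤ) :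
    Γ.crossAction g (x, n) = (Γ.artinToCoxeter g * x * (Γ.artinToCoxeter g)⁻¹,
      n + (Γ.crossAction g (x, 0)).2) := by
  have hg : g ∈ Subgroup.closure (Set.range Γ.σ) := by
    rw [closure_range_σ]
    trivial
  induction hg using Subgroup.closure_induction generalizing x n with
  | mem y hy =>
    obtain ⟨v, rfl⟩ := hy
    have e : Γ.σ v = Γ.artinWord [v] := by simp [artinWord]
    rw [e, crossAction_artinWord, crossAction_artinWord, artinToCoxeter_artinWord, zero_add]
  | one => simp
  | mul y z _ _ hy hz =>
    rw [map_mul, Equiv.Perm.mul_apply, Equiv.Perm.mul_apply, hz, hy, hz x 0, hy _ (0 + _), map_mul]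
    ext
    · simp [mul_assoc]
    · simp [add_assoc]
  | inv y _ hy =>
    rw [map_inv, Equiv.Perm.inv_eq_iff_eq, hy]
    set p := (Γ.crossAction y)⁻¹ (x, 0) with hp
    have h1 : Γ.crossAction y p = (x, 0) := by simp [hp]
    obtain ⟨a, b⟩ := p
    rw [hy, Prod.mk.injEq] at h1
    obtain ⟨h1, h2⟩ := h1
    ext
    · simp [mul_assoc]
    · have : (Γ.artinToCoxeter y)⁻¹ * x * (Γ.artinToCoxeter y) = a := by
        rw [← h1]; simp [mul_assoc]
      simp only [map_inv, inv_inv, this]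
      omega

/-- The signed number of crossings of a wall by an element of the Artin group. -/
noncomputable def crossNumber (g : Γ.ArtinGroup) (x : Γ.CoxeterGroupOf) : ℤ :=
  (Γ.crossAction g (x, 0)).2

variable {Γ}

theorem crossNumber_mul (g : Γ.ArtinGroup) {h : Γ.ArtinGroup} {x : Γ.CoxeterGroupOf}
    (hh : Commute (Γ.artinToCoxeter h) x) :
    Γ.crossNumber (g * h) x = Γ.crossNumber g x + Γ.crossNumber h x := by
  rw [crossNumber, map_mul, Equiv.Perm.mul_apply, crossAction_apply _ h, hh.eq,
    mul_inv_cancel_right, crossAction_apply _ g, zero_add, add_comm]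
  rfl

theorem crossNumber_conj {g a : Γ.ArtinGroup} (h : Commute g a) {x : Γ.CoxeterGroupOf}
    (hg : Commute (Γ.artinToCoxeter g) x) :
    Γ.crossNumber g (Γ.artinToCoxeter a * x * (Γ.artinToCoxeter a)⁻¹) = Γ.crossNumber g x := by
  have e := DFunLike.congr_fun (congrArg Γ.crossAction h) (x, 0)
  rw [map_mul, map_mul, Equiv.Perm.mul_apply, Equiv.Perm.mul_apply] at e
  have e1 := Γ.crossAction_apply a x 0
  have e2 := Γ.crossAction_apply g x 0
  have := congrArg Prod.snd e
  rw [e1, e2, crossAction_apply, Γ.crossAction_apply a _ (0 + _), hg.eq,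
    mul_inv_cancel_right] at this
  simp only [crossNumber]
  omega

/-- The subgroup of elements that normalize a wall without crossing it. -/
noncomputable def uncrossing (x : Γ.CoxeterGroupOf) : Subgroup Γ.ArtinGroup where
  carrier := {g | Commute (Γ.artinToCoxeter g) x ∧ Γ.crossNumber g x = 0}
  one_mem' := by simp [crossNumber]
  mul_mem' {g h} hg hh := by
    refine ⟨?_, ?_⟩
    · rw [map_mul]
      exact hg.1.mul_left hh.1
    · rw [crossNumber_mul _ hh.1, hg.2, hh.2, add_zero]
  inv_mem' {g} hg := by
    refine ⟨?_, ?_⟩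
    · rw [map_inv]
      exact hg.1.inv_left
    · have h1 := crossNumber_mul g⁻¹ hg.1
      rw [inv_mul_cancel, hg.2, add_zero] at h1
      rw [← h1]
      simp [crossNumber]

/-- The wall crossing numbers as a homomorphism on a group that normalizes the wall. -/
noncomputable def crossHom {Z : Type*} [Group Z] (φ : Z →* Γ.ArtinGroup) (x : Γ.CoxeterGroupOf)
    (h : ∀ z, Commute (Γ.artinToCoxeter (φ z)) x) : Additive Z →+ ℤ :=
  AddMonoidHom.mk' (fun z => Γ.crossNumber (φ z.toMul) x) fun a b => by
    rw [toMul_add, map_mul, crossNumber_mul _ (h _)]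

variable {V' : Type*} {Δ : LabelledGraph V'}

theorem coxMatrix_map {f : V' → V} (hf : Function.Injective f)
    (hm : ∀ u v, Δ.m u v = Γ.m (f u) (f v)) (u v : V') :
    Δ.coxMatrix u v = Γ.coxMatrix (f u) (f v) := by
  rcases eq_or_ne u v with rfl | h
  · simp
  · simp [coxMatrix, h, hf.ne h, hm]

/-- The homomorphism between Coxeter groups induced by a label-preserving injection. -/
noncomputable def coxMapHom {f : V' → V} (hf : Function.Injective f)
    (hm : ∀ u v, Δ.m u v = Γ.m (f u) (f v)) : Δ.CoxeterGroupOf →* Γ.CoxeterGroupOf :=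
  Δ.coxSystem.lift ⟨fun v => Γ.coxSystem.simple (f v), fun u v => by
    rw [coxMatrix_map hf hm, simple_mul_simple_pow]⟩

theorem coxMapHom_simple {f : V' → V} (hf : Function.Injective f)
    (hm : ∀ u v, Δ.m u v = Γ.m (f u) (f v)) (v : V') :
    coxMapHom hf hm (Δ.coxSystem.simple v) = Γ.coxSystem.simple (f v) :=
  lift_apply_simple _ _ _

theorem coxMapHom_wordProd {f : V' → V} (hf : Function.Injective f)
    (hm : ∀ u v, Δ.m u v = Γ.m (f u) (f v)) (ω : List V') :
    coxMapHom hf hm (Δ.coxSystem.wordProd ω) = Γ.coxSystem.wordProd (ω.map f) := by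
  rw [wordProd, wordProd, map_list_prod, List.map_map, List.map_map]
  congr 2

theorem Spherical.of_bijective (h : Δ.Spherical) {f : V' → V} (hf : Function.Bijective f)
    (hm : ∀ u v, Δ.m u v = Γ.m (f u) (f v)) : Γ.Spherical := by
  have : Finite Δ.CoxeterGroupOf := h
  refine Finite.of_surjective (coxMapHom hf.1 hm) ?_
  rw [← MonoidHom.range_eq_top, eq_top_iff, ← Γ.coxSystem.subgroup_closure_range_simple,
    Subgroup.closure_le]
  rintro _ ⟨v, rfl⟩
  obtain ⟨u, rfl⟩ := hf.2 v
  exact ⟨_, coxMapHom_simple hf.1 hm u⟩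

variable (Γ)

theorem inclHom_artinWord (X : Set V) (ω : List X) :
    Γ.inclHom X ((Γ.induce X).artinWord ω) = Γ.artinWord (ω.map Subtype.val) := by
  rw [artinWord, artinWord, map_list_prod, List.map_map, List.map_map]
  congr 2

/-- The properties of the full twist of a spherical special subgroup. -/
theorem exists_fullTwist {X : Set V} (hX : (Γ.induce X).Spherical) :
    ∃ c : Γ.ArtinGroup, c ∈ (Γ.inclHom X).range ∧ Γ.artinToCoxeter c = 1 ∧
      (∀ v ∈ X, Commute c (Γ.σ v)) ∧
      (∀ v ∈ X, Γ.crossNumber c (Γ.coxSystem.simple v) ≠ 0) ∧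
      ∀ x ∉ Γ.coxSystem.parabolic X, Γ.crossNumber c x = 0 := by
  classical
  obtain ⟨ω, hsq, hcomm, hend⟩ := hX.exists_halfTwist
  have hcross : ∀ x η, Γ.crossNumber (Γ.artinWord η) x =
      ((Γ.coxSystem.rightInvSeq η).count x : ℤ) := by
    intro x η
    simp [crossNumber, crossAction_artinWord]
  refine ⟨Γ.artinWord ((ω ++ ω).map Subtype.val), ⟨_, Γ.inclHom_artinWord X _⟩, ?_,
    fun v hv => ?_, fun v hv => ?_, fun x hx => ?_⟩
  · rw [artinToCoxeter_artinWord,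
      ← coxMapHom_wordProd (Δ := Γ.induce X) Subtype.val_injective (fun _ _ => rfl),
      wordProd_append, hsq, map_one]
  · have := (hcomm ⟨v, hv⟩).map (Γ.inclHom X)
    rwa [inclHom_artinWord, inclHom_σ] at this
  · obtain ⟨η, hη⟩ := hend ⟨v, hv⟩
    have h1 := congrArg (fun a => Γ.artinWord (ω.map Subtype.val) * Γ.inclHom X a) hη
    simp only [inclHom_artinWord, ← artinWord_append, ← List.map_append] at h1
    rw [← h1, hcross, ne_eq, Nat.cast_eq_zero, List.count_eq_zero, not_not,
      List.concat_eq_append, ← List.append_assoc, List.map_append,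
      List.map_singleton, ← List.concat_eq_append]
    exact Γ.coxSystem.simple_mem_rightInvSeq_concat _ _
  · rw [hcross, Nat.cast_eq_zero, List.count_eq_zero]
    refine fun h => hx (Γ.coxSystem.mem_parabolic_of_mem_rightInvSeq (fun i hi => ?_) h)
    obtain ⟨j, -, rfl⟩ := List.mem_map.mp hi
    exact j.2

end LabelledGraph

namespace Monoid.PushoutI

open Monoid.CoprodI

variable {ι : Type*} {G : ι → Type*} {H : Type*} [∀ i, Group (G i)] [Group H] {φ : ∀ i, H →* G i}

theorem exists_eq_base_mul_reduced (hφ : ∀ i, Function.Injective (φ i)) (z : PushoutI φ) :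
    ∃ (h : H) (w : Word G), Reduced φ w ∧ z = base φ h * ofCoprodI w.prod := by
  classical
  obtain ⟨d⟩ := NormalWord.transversal_nonempty φ hφ
  obtain ⟨w, rfl⟩ := (NormalWord.equiv (d := d)).symm.surjective z
  refine ⟨w.head, w.toWord, fun g hg hr => w.ne_one g hg ?_, rfl⟩
  have h1 := w.normalized g.1 g.2 hg
  exact (Prod.ext_iff.mp (((d.compl g.1).existsUnique g.2).unique
    (y₁ := (⟨g.2, hr⟩, ⟨1, d.one_mem _⟩)) (y₂ := (⟨1, one_mem _⟩, ⟨g.2, h1⟩))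
    (by simp) (by simp))).2 |> Subtype.ext_iff.mp |>.symm

theorem Reduced.map_fst_eq (hφ : ∀ i, Function.Injective (φ i)) {w w' : Word G}
    (hw : Reduced φ w) (hw' : Reduced φ w')
    (h : (ofCoprodI w.prod : PushoutI φ) = ofCoprodI w'.prod) :
    w.toList.map Sigma.fst = w'.toList.map Sigma.fst := by
  obtain ⟨d⟩ := NormalWord.transversal_nonempty φ hφ
  obtain ⟨n, hn, e⟩ := hw.exists_normalWord_prod_eq d
  obtain ⟨n', hn', e'⟩ := hw'.exists_normalWord_prod_eq d
  rw [← hn, ← hn'] at h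
  rw [← e, ← e', NormalWord.prod_injective h]

/-- The center of an amalgamated product in which no index is the only one whose factor is
larger than the base group is contained in the base group. -/
theorem center_le_range_base (hφ : ∀ i, Function.Injective (φ i))
    (hne : ∀ i, ∃ j, j ≠ i ∧ ∃ b : G j, b ∉ (φ j).range) :
    Subgroup.center (PushoutI φ) ≤ (base φ).range := by
  intro z hz
  obtain ⟨h, w, hw, rfl⟩ := exists_eq_base_mul_reduced hφ z
  suffices hnil : w.toList = [] by
    exact ⟨h, by simp [Word.prod, hnil]⟩
  by_contra hnil
  obtain ⟨j, hj, b, hb⟩ := hne (w.toList.getLast hnil).1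
  have hb1 : ∀ {b : G j}, b ∉ (φ j).range → b ≠ 1 := by
    rintro _ hb rfl
    exact hb (one_mem _)
  let inv : (Σ i, G i) → Σ i, G i := fun g => ⟨g.1, g.2⁻¹⟩
  let w' : Word G :=
    { toList := w.toList ++ ⟨j, b⟩ :: (w.toList.map inv).reverse
      ne_one := by
        intro g hg
        simp only [List.mem_append, List.mem_cons, List.mem_reverse, List.mem_map] at hg
        rcases hg with hg | rfl | ⟨g, hg, rfl⟩
        · exact w.ne_one g hg
        · exact hb1 hb
        · simpa [inv] using w.ne_one g hg
      chain_ne := by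
        have hlast : ∀ x ∈ w.toList.getLast?, x.1 ≠ j := by
          intro x hx
          rw [List.getLast?_eq_getLast_of_ne_nil hnil, Option.mem_some_iff] at hx
          exact hx ▸ hj.symm
        rw [List.isChain_append, List.isChain_cons, List.isChain_reverse, List.isChain_map]
        refine ⟨w.chain_ne, ⟨fun x hx => ?_, ?_⟩, fun x hx y hy => ?_⟩
        · rw [List.head?_reverse, List.getLast?_map, Option.mem_map] at hx
          obtain ⟨y, hy, rfl⟩ := hx
          exact (hlast y hy).symm
        · exact w.chain_ne.imp fun _ _ h => h.symm
        · rw [List.head?_cons, Option.mem_some_iff] at hy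
          exact hy ▸ hlast x hx }
  have hw' : Reduced φ w' := by
    intro g hg
    simp only [w', List.mem_append, List.mem_cons, List.mem_reverse, List.mem_map] at hg
    rcases hg with hg | rfl | ⟨g, hg, rfl⟩
    · exact hw g hg
    · exact hb
    · simpa [inv] using hw g hg
  have hb' : φ j h⁻¹ * b * φ j h ∉ (φ j).range := by
    rwa [mul_mem_cancel_right (MonoidHom.mem_range.mpr ⟨h, rfl⟩),
      mul_mem_cancel_left (MonoidHom.mem_range.mpr ⟨h⁻¹, rfl⟩)]
  let w'' : Word G :=
    { toList := [⟨j, φ j h⁻¹ * b * φ j h⟩]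
      ne_one := by simpa using hb1 hb'
      chain_ne := by simp }
  have hw'' : Reduced φ w'' := by simpa [Reduced, w''] using hb'
  have hinv : ((w.toList.map inv).reverse.map fun l => CoprodI.of l.snd).prod = w.prod⁻¹ := by
    rw [Word.prod, List.prod_inv_reverse, List.map_reverse, List.map_map, List.map_map]
    simp [inv, Function.comp_def]
  have hprod : (ofCoprodI w'.prod : PushoutI φ) = ofCoprodI w''.prod := by
    have e1 : w'.prod = w.prod * CoprodI.of b * w.prod⁻¹ := by
      rw [← hinv]
      simp [w', Word.prod, mul_assoc]
    have e2 : w''.prod = CoprodI.of (φ j h⁻¹ * b * φ j h) := by simp [w'', Word.prod]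
    have e3 := Subgroup.mem_center_iff.mp hz (of j b)
    rw [e1, e2, map_mul, map_mul, map_inv, ofCoprodI_of, ofCoprodI_of, map_mul, map_mul,
      of_apply_eq_base, of_apply_eq_base, map_inv, mul_inv_eq_iff_eq_mul]
    rw [← mul_assoc] at e3
    rw [mul_assoc, mul_assoc, ← mul_assoc (of j b), e3]
    simp [mul_assoc]
  have hlen := congrArg List.length (hw'.map_fst_eq hφ hw'' hprod)
  have := List.length_pos_iff.mpr hnil
  simp [w', w''] at hlen
  omega

end Monoid.PushoutI

namespace LabelledGraph

variable {V : Type*} (Γ : LabelledGraph V)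

theorem artinToCoxeter_mem_parabolic {K : Set V} {g : Γ.ArtinGroup}
    (hg : g ∈ (Γ.inclHom K).range) : Γ.artinToCoxeter g ∈ Γ.coxSystem.parabolic K := by
  obtain ⟨g, rfl⟩ := hg
  have hg : g ∈ Subgroup.closure (Set.range (Γ.induce K).σ) := by
    rw [closure_range_σ]
    trivial
  induction hg using Subgroup.closure_induction with
  | mem x hx =>
    obtain ⟨k, rfl⟩ := hx
    rw [inclHom_σ, artinToCoxeter_σ]
    exact Γ.coxSystem.simple_mem_parabolic k.2
  | one => simp
  | mul x y _ _ hx hy =>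
    rw [map_mul, map_mul]
    exact mul_mem hx hy
  | inv x _ hx =>
    rw [map_inv, map_inv]
    exact inv_mem hx

theorem mem_of_σ_mem_range_inclHom {K : Set V} {v : V} (h : Γ.σ v ∈ (Γ.inclHom K).range) :
    v ∈ K := by
  have := Γ.artinToCoxeter_mem_parabolic h
  rw [artinToCoxeter_σ] at this
  exact Γ.coxSystem.mem_of_simple_mem_parabolic this

/-- If a labelled graph is covered by full subgraphs with common pairwise intersection,
then its Artin group is an amalgamated product and its center lies in the base group. -/
theorem center_le_range_inclHom {ι : Type*} [Nonempty ι] {K : ι → Set V} {L : Set V}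
    (hLK : ∀ i, L ⊆ K i) (hKL : ∀ i j, i ≠ j → K i ∩ K j ⊆ L) (hcov : ∀ v, ∃ i, v ∈ K i)
    (hedge : ∀ u v, u ≠ v → Γ.m u v ≠ ⊤ → ∃ i, u ∈ K i ∧ v ∈ K i)
    (hne : ∀ i, ∃ j, j ≠ i ∧ ∃ v ∈ K j, v ∉ L) :
    Subgroup.center Γ.ArtinGroup ≤ (Γ.inclHom L).range := by
  let φ : ∀ i, (Γ.induce L).ArtinGroup →* (Γ.induce (K i)).ArtinGroup :=
    fun i => Γ.induceHom (hLK i)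
  have hφ : ∀ i, Function.Injective (φ i) := fun i a b hab => Γ.inclHom_injective L (by
    rw [← Γ.inclHom_induceHom (K i) (hLK i), ← Γ.inclHom_induceHom (K i) (hLK i)]
    exact congrArg _ hab)
  have hof : ∀ i j v (hi : v ∈ K i) (hj : v ∈ K j),
      (Monoid.PushoutI.of i ((Γ.induce (K i)).σ ⟨v, hi⟩) : Monoid.PushoutI φ) =
        Monoid.PushoutI.of j ((Γ.induce (K j)).σ ⟨v, hj⟩) := by
    intro i j v hi hj
    rcases eq_or_ne i j with rfl | hij
    · rfl
    have hv := hKL i j hij ⟨hi, hj⟩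
    have := Monoid.PushoutI.of_apply_eq_base φ i ((Γ.induce L).σ ⟨v, hv⟩)
    rw [← Monoid.PushoutI.of_apply_eq_base φ j] at this
    simpa only [φ, induceHom_σ] using this
  choose p hp using hcov
  let Ψ : Γ.ArtinGroup →* Monoid.PushoutI φ :=
    Γ.artinLift (fun v => Monoid.PushoutI.of (p v) ((Γ.induce (K (p v))).σ ⟨v, hp v⟩)) (by
      intro u v k huv hk
      obtain ⟨i, hu, hv⟩ := hedge u v huv (by simp [hk])
      rw [hof _ i u _ hu, hof _ i v _ hv, ← map_altProd, ← map_altProd,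
        (Γ.induce (K i)).altProd_σ_comm (u := ⟨u, hu⟩) (v := ⟨v, hv⟩) (by simpa using huv) hk])
  let Φ : Monoid.PushoutI φ →* Γ.ArtinGroup :=
    Monoid.PushoutI.lift (fun i => Γ.inclHom (K i)) (Γ.inclHom L)
      fun i => MonoidHom.ext fun g => Γ.inclHom_induceHom _ _ g
  have h1 : Φ.comp Ψ = MonoidHom.id _ := artinHom_ext fun v => by
    simp [Φ, Ψ, inclHom_σ]
  have h2 : Ψ.comp Φ = MonoidHom.id _ := Monoid.PushoutI.hom_ext_nonempty fun i =>
    artinHom_ext fun v => by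
      simp only [Φ, Ψ, MonoidHom.comp_apply, Monoid.PushoutI.lift_of, inclHom_σ, artinLift_σ,
        MonoidHom.id_apply]
      exact hof _ _ _ _ _
  intro z hz
  have hΨz : Ψ z ∈ Subgroup.center (Monoid.PushoutI φ) := by
    rw [Subgroup.mem_center_iff]
    intro x
    have hx : Ψ (Φ x) = x := DFunLike.congr_fun h2 x
    rw [← hx, ← map_mul, ← map_mul, Subgroup.mem_center_iff.mp hz]
  obtain ⟨h, e⟩ := Monoid.PushoutI.center_le_range_base hφ (fun i => by
    obtain ⟨j, hj, v, hv, hvL⟩ := hne i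
    refine ⟨j, hj, (Γ.induce (K j)).σ ⟨v, hv⟩, ?_⟩
    rintro ⟨b, hb⟩
    refine hvL (Γ.mem_of_σ_mem_range_inclHom ⟨b, ?_⟩)
    rw [← Γ.inclHom_induceHom (K j) (hLK j)]
    exact (congrArg _ hb).trans (Γ.inclHom_σ _ _)) hΨz
  refine ⟨h, ?_⟩
  have hz' : Φ (Ψ z) = z := DFunLike.congr_fun h1 z
  rw [← hz', ← e]
  simp [Φ]

/-- The center of an Artin group is contained in the special subgroup on the cone points. -/
theorem center_le_range_inclHom_conePoints [Finite V] :
    Subgroup.center Γ.ArtinGroup ≤ (Γ.inclHom {t | Γ.IsConePoint t}).range := by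
  classical
  have hpair : ∀ s t, s ≠ t → Γ.m s t = ⊤ →
      Subgroup.center Γ.ArtinGroup ≤ (Γ.inclHom ({t}ᶜ : Set V)).range := by
    intro s t hst hm z hz
    have hm' : Γ.m t s = ⊤ := by rw [Γ.symm, hm]
    have := Γ.center_le_range_inclHom (K := fun b : Bool => bif b then {s}ᶜ else {t}ᶜ)
      (L := {s}ᶜ ∩ {t}ᶜ) (by rintro (_ | _) <;> simp) (by
        rintro (_ | _) (_ | _) h
        exacts [absurd rfl h, (Set.inter_comm _ _).le, le_rfl, absurd rfl h]) (by
        intro v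
        rcases eq_or_ne v s with rfl | h
        · exact ⟨false, by simpa using hst⟩
        · exact ⟨true, by simpa using h⟩) (by
        intro u v huv h
        by_cases h1 : u ≠ s ∧ v ≠ s
        · exact ⟨true, by simpa using h1⟩
        · refine ⟨false, ?_⟩
          simp only [cond_false, Set.mem_compl_iff, Set.mem_singleton_iff]
          constructor
          · rintro rfl; grind
          · rintro rfl; grind) (by
        rintro (_ | _)
        · exact ⟨true, by simp, t, by simpa using hst.symm, by simp⟩
        · exact ⟨false, by simp, s, by simpa using hst, by simp⟩) hz
    obtain ⟨a, rfl⟩ := this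
    exact ⟨_, Γ.inclHom_induceHom _ (Set.inter_subset_right) a⟩
  have hfin : ∀ S : Finset V, (∀ v ∈ S, ¬ Γ.IsConePoint v) →
      Subgroup.center Γ.ArtinGroup ≤ (Γ.inclHom ((S : Set V)ᶜ)).range := by
    intro S
    induction S using Finset.induction_on with
    | empty =>
      intro _ z _
      have hz : z ∈ Subgroup.closure (Set.range Γ.σ) := by
        rw [closure_range_σ]
        trivial
      refine (Subgroup.closure_le _).mpr ?_ hz
      rintro _ ⟨v, rfl⟩
      exact ⟨_, Γ.inclHom_σ _ ⟨v, by simp⟩⟩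
    | insert t S _ ih =>
      intro hS z hz
      obtain ⟨s, hst, hm⟩ : ∃ s, s ≠ t ∧ Γ.m t s = ⊤ := by
        simpa [IsConePoint] using hS t (by simp)
      have h1 := hpair s t hst (by rw [Γ.symm, hm]) hz
      have h2 := ih (fun v hv => hS v (by simp [hv])) hz
      have := Γ.range_inclHom_inf _ _ ⟨h1, h2⟩
      rwa [Finset.coe_insert, Set.insert_eq, Set.compl_union]
  have hT : ((Set.toFinite {v | ¬ Γ.IsConePoint v}).toFinset : Set V)ᶜ =
      {t | Γ.IsConePoint t} := by
    ext
    simp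
  rw [← hT]
  exact hfin _ (by simp)

end LabelledGraph

section Rank

variable {E : Type*} [AddCommGroup E]

theorem linearIndependent_of_apply_eq_zero {J : Type*} {C : J → E} {f : J → E →+ ℤ}
    (h1 : ∀ j, f j (C j) ≠ 0) (h2 : ∀ i j, i ≠ j → f j (C i) = 0) : LinearIndependent ℤ C := by
  classical
  rw [linearIndependent_iff']
  intro s a ha j hj
  have := congrArg (f j) ha
  rw [map_sum, map_zero, Finset.sum_eq_single j] at this
  · simpa [h1 j] using this
  · intro i _ hij
    rw [map_zsmul, h2 i j hij, smul_zero]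
  · exact fun h => absurd hj h

theorem exists_smul_mem_span_of_card_eq {J : Type*} [Finite J] {C : J → E}
    (hC : LinearIndependent ℤ C) (e : E ≃+ (Fin (Nat.card J) → ℤ)) (z : E) :
    ∃ n : ℤ, n ≠ 0 ∧ n • z ∈ Submodule.span ℤ (Set.range C) := by
  have := Fintype.ofFinite J
  have : Module.Finite ℤ E := Module.Finite.equiv e.toIntLinearEquiv.symm
  have hq := (Submodule.span ℤ (Set.range C)).finrank_quotient_add_finrank
  rw [finrank_span_eq_card hC, e.toIntLinearEquiv.finrank_eq, Module.finrank_fin_fun,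
    Nat.card_eq_fintype_card, add_eq_right] at hq
  obtain ⟨n, hn, h⟩ := Module.finrank_eq_zero_iff.mp hq (Submodule.Quotient.mk z)
  refine ⟨n, hn, ?_⟩
  rwa [← Submodule.Quotient.mk_smul, Submodule.Quotient.mk_eq_zero] at h

theorem nonempty_addEquiv_of_span {F : Type*} [AddCommGroup F] [Module.Free ℤ F]
    [Module.Finite ℤ F] {ι : E →+ F} (hι : Function.Injective ι) {J : Type*} [Finite J] {D : J → E}
    (hD : LinearIndependent ℤ D)
    (hs : ∀ z, ∃ n : ℤ, n ≠ 0 ∧ n • z ∈ Submodule.span ℤ (Set.range D)) :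
    Nonempty (E ≃+ (Fin (Nat.card J) → ℤ)) := by
  have := Fintype.ofFinite J
  let e := LinearEquiv.ofInjective ι.toIntLinearMap hι
  have : Module.Free ℤ E := Module.Free.of_equiv e.symm
  have : Module.Finite ℤ E := Module.Finite.equiv e.symm
  have hq := (Submodule.span ℤ (Set.range D)).finrank_quotient_add_finrank
  have h0 : Module.finrank ℤ (E ⧸ Submodule.span ℤ (Set.range D)) = 0 := by
    refine Module.finrank_eq_zero_iff.mpr fun z => ?_
    obtain ⟨z, rfl⟩ := Submodule.Quotient.mk_surjective _ z
    obtain ⟨n, hn, h⟩ := hs z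
    exact ⟨n, hn, by rwa [← Submodule.Quotient.mk_smul, Submodule.Quotient.mk_eq_zero]⟩
  rw [h0, finrank_span_eq_card hD, zero_add, ← Nat.card_eq_fintype_card] at hq
  exact ⟨(Module.finBasisOfFinrankEq ℤ E hq.symm).equivFun.toAddEquiv⟩

end Rank

namespace LabelledGraph

variable {V : Type*} {Γ : LabelledGraph V}

theorem exists_isIrredDecomp [Finite V] (Γ : LabelledGraph V) :
    ∃ (n : ℕ) (P : Fin n → Set V), Γ.IsIrredDecomp n P := by
  let G : SimpleGraph V :=
    { Adj := fun u v => u ≠ v ∧ Γ.m u v ≠ 2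
      symm := ⟨fun u v h => ⟨h.1.symm, by rw [Γ.symm]; exact h.2⟩⟩
      loopless := ⟨fun u h => h.1 rfl⟩ }
  let e := Finite.equivFin G.ConnectedComponent
  refine ⟨_, fun i => (e.symm i).supp, fun i => (e.symm i).nonempty_supp, ?_, ?_, ?_, ?_⟩
  · rw [Set.eq_univ_iff_forall]
    exact fun v => Set.mem_iUnion.mpr ⟨e (G.connectedComponentMk v), by simp⟩
  · intro i j hij
    rw [Set.disjoint_left]
    intro v hi hj
    rw [SimpleGraph.ConnectedComponent.mem_supp_iff] at hi hj
    exact hij (e.symm.injective (hi.symm.trans hj))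
  · intro i j hij u hu v hv
    rw [SimpleGraph.ConnectedComponent.mem_supp_iff] at hu hv
    have huv : G.connectedComponentMk u ≠ G.connectedComponentMk v := fun h =>
      hij (e.symm.injective (hu.symm.trans (h.trans hv)))
    by_contra h
    exact huv (SimpleGraph.ConnectedComponent.connectedComponentMk_eq_of_adj
      ⟨fun h => huv (congrArg _ h), h⟩)
  · rintro i ⟨V₁, V₂, ⟨u, hu⟩, ⟨v, hv⟩, hd, hU, h2⟩
    have hr : G.Reachable u v := SimpleGraph.ConnectedComponent.exact (u.2.trans v.2.symm)
    rw [SimpleGraph.reachable_iff_reflTransGen] at hr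
    have key : ∀ w, Relation.ReflTransGen G.Adj u w → ∃ h, (⟨w, h⟩ : (e.symm i).supp) ∈ V₁ := by
      intro w hw
      induction hw with
      | refl => exact ⟨u.2, hu⟩
      | @tail a b _ hab ih =>
        obtain ⟨ha, haV⟩ := ih
        have hb : b ∈ (e.symm i).supp :=
          (SimpleGraph.ConnectedComponent.connectedComponentMk_eq_of_adj hab).symm.trans ha
        refine ⟨hb, ?_⟩
        have hb' : (⟨b, hb⟩ : (e.symm i).supp) ∈ V₁ ∪ V₂ := hU ▸ Set.mem_univ _
        exact hb'.resolve_right fun h => hab.2 (h2 _ haV _ h)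
    obtain ⟨_, h⟩ := key v hr
    exact Set.disjoint_left.mp hd h hv

theorem IsIrredDecomp.subset_of_inter_nonempty {n : ℕ} {P : Fin n → Set V}
    (hP : Γ.IsIrredDecomp n P) {Y : Set V} (hY : ∀ u ∈ Y, ∀ v ∉ Y, Γ.m u v = 2) {i : Fin n}
    (h : (P i ∩ Y).Nonempty) : P i ⊆ Y := by
  obtain ⟨t, ht, htY⟩ := h
  intro s hs
  by_contra hsY
  refine hP.2.2.2.2 i ⟨Subtype.val ⁻¹' Y, Subtype.val ⁻¹' Yᶜ, ⟨⟨t, ht⟩, htY⟩, ⟨⟨s, hs⟩, hsY⟩,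
    ?_, ?_, fun u hu v hv => hY u hu v hv⟩
  · exact Disjoint.preimage _ disjoint_compl_right
  · rw [← Set.preimage_union, Set.union_compl_self, Set.preimage_univ]

theorem IsIrredDecomp.eq_two_of_not_mem {n : ℕ} {P : Fin n → Set V}
    (hP : Γ.IsIrredDecomp n P) {i : Fin n} {u v : V} (hu : u ∈ P i) (hv : v ∉ P i) :
    Γ.m u v = 2 := by
  obtain ⟨j, hj⟩ := Set.mem_iUnion.mp (hP.2.1 ▸ Set.mem_univ v)
  exact hP.2.2.2.1 i j (fun h => hv (h ▸ hj)) u hu v hj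

end LabelledGraph

namespace LabelledGraph

open CoxeterSystem

variable {V : Type*} (Γ : LabelledGraph V)

open scoped Classical in
/-- The full twist of a spherical special subgroup. -/
noncomputable def fullTwist (X : Set V) : Γ.ArtinGroup :=
  if h : (Γ.induce X).Spherical then (Γ.exists_fullTwist h).choose else 1

variable {Γ}

theorem fullTwist_spec {X : Set V} (hX : (Γ.induce X).Spherical) :
    Γ.fullTwist X ∈ (Γ.inclHom X).range ∧ Γ.artinToCoxeter (Γ.fullTwist X) = 1 ∧
      (∀ v ∈ X, Commute (Γ.fullTwist X) (Γ.σ v)) ∧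
      (∀ v ∈ X, Γ.crossNumber (Γ.fullTwist X) (Γ.coxSystem.simple v) ≠ 0) ∧
      ∀ x ∉ Γ.coxSystem.parabolic X, Γ.crossNumber (Γ.fullTwist X) x = 0 := by
  rw [fullTwist, dif_pos hX]
  exact (Γ.exists_fullTwist hX).choose_spec

theorem commute_σ_of_eq_two {u v : V} (h : Γ.m u v = 2) : Commute (Γ.σ u) (Γ.σ v) := by
  rcases eq_or_ne u v with rfl | huv
  · exact Commute.refl _
  · have := Γ.altProd_σ_comm huv (k := 2) h
    simp only [altProd, mul_one] at this
    exact this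

theorem commute_of_commute_σ {a : Γ.ArtinGroup} (h : ∀ v, Commute a (Γ.σ v)) (b : Γ.ArtinGroup) :
    Commute a b := by
  have hb : b ∈ Subgroup.closure (Set.range Γ.σ) := by
    rw [closure_range_σ]
    trivial
  induction hb using Subgroup.closure_induction with
  | mem x hx =>
    obtain ⟨v, rfl⟩ := hx
    exact h v
  | one => exact Commute.one_right a
  | mul x y _ _ hx hy => exact hx.mul_right hy
  | inv x _ hx => exact hx.inv_right

theorem commute_fullTwist_σ {X : Set V} (hX : (Γ.induce X).Spherical) {v : V}
    (hv : v ∉ X → ∀ u ∈ X, Γ.m u v = 2) : Commute (Γ.fullTwist X) (Γ.σ v) := by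
  by_cases h : v ∈ X
  · exact (fullTwist_spec hX).2.2.1 v h
  obtain ⟨⟨b, hb⟩, -⟩ := fullTwist_spec hX
  rw [← hb]
  have hr : b ∈ Subgroup.closure (Set.range (Γ.induce X).σ) := by
    rw [closure_range_σ]
    trivial
  clear hb
  induction hr using Subgroup.closure_induction with
  | mem x hx =>
    obtain ⟨u, rfl⟩ := hx
    rw [inclHom_σ]
    exact commute_σ_of_eq_two (hv h u u.2)
  | one => rw [map_one]; exact Commute.one_left _
  | mul x y _ _ hx hy => rw [map_mul]; exact hx.mul_left hy
  | inv x _ hx => rw [map_inv]; exact hx.inv_left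

theorem commute_simple_of_commute_σ {a : Γ.ArtinGroup} {v : V} (h : Commute a (Γ.σ v)) :
    Commute (Γ.artinToCoxeter a) (Γ.coxSystem.simple v) := by
  rw [← artinToCoxeter_σ]
  exact h.map Γ.artinToCoxeter

theorem crossNumber_fullTwist_simple_eq_zero {X : Set V} (hX : (Γ.induce X).Spherical) {v : V}
    (hv : v ∉ X) : Γ.crossNumber (Γ.fullTwist X) (Γ.coxSystem.simple v) = 0 :=
  (fullTwist_spec hX).2.2.2.2 _ fun h => hv (Γ.coxSystem.mem_of_simple_mem_parabolic h)

theorem IsIrredDecomp.exists_eq_image {T : Set V} {m n : ℕ} {Q : Fin m → Set T} {P : Fin n → Set V}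
    (hQ : (Γ.induce T).IsIrredDecomp m Q) (hP : Γ.IsIrredDecomp n P) (j : Fin m)
    (h : ∀ u ∈ Subtype.val '' Q j, ∀ v ∉ Subtype.val '' Q j, Γ.m u v = 2) :
    ∃ i, P i = Subtype.val '' Q j := by
  obtain ⟨t, ht⟩ := hQ.1 j
  obtain ⟨i, hi⟩ := Set.mem_iUnion.mp (hP.2.1 ▸ Set.mem_univ (t : V))
  refine ⟨i, (hP.subset_of_inter_nonempty h ⟨t, hi, t, ht, rfl⟩).antisymm ?_⟩
  rw [Set.image_subset_iff]
  exact hQ.subset_of_inter_nonempty (Y := Subtype.val ⁻¹' P i)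
    (fun u hu v hv => hP.eq_two_of_not_mem hu hv) ⟨t, ht, hi⟩

theorem Spherical.induce_image {T : Set V} {Q : Set T} (h : ((Γ.induce T).induce Q).Spherical) :
    (Γ.induce (Subtype.val '' Q)).Spherical :=
  h.of_bijective (f := fun q => ⟨q.1.1, q.1, q.2, rfl⟩)
    ⟨fun a b hab => Subtype.ext (Subtype.ext (congrArg (fun x => (x.1 : V)) hab)), by
      rintro ⟨_, q, hq, rfl⟩
      exact ⟨⟨q, hq⟩, rfl⟩⟩ fun _ _ => rfl

end LabelledGraph

open LabelledGraph CoxeterSystem IsMulCommutative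

/-- If the induced subgraph on the set of cone points of `Γ` satisfies
the Center Conjecture, then so does `Γ`. -/
theorem satisfiesCenterConjecture_of_conePoints {V : Type*} [Finite V] (Γ : LabelledGraph V)
    (h : (Γ.induce {t | Γ.IsConePoint t}).SatisfiesCenterConjecture) :
    Γ.SatisfiesCenterConjecture := by
  set T := {t | Γ.IsConePoint t}
  obtain ⟨m, Q, hQ⟩ := exists_isIrredDecomp (Γ.induce T)
  obtain ⟨e⟩ := h m Q hQ
  have e' := MulEquiv.toAdditiveLeft e
  set J := {j : Fin m // ((Γ.induce T).induce (Q j)).Spherical}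
  let X : Fin m → Set V := fun j => Subtype.val '' Q j
  have hX : ∀ j : J, (Γ.induce (X j)).Spherical := fun j => j.2.induce_image
  have hXX : ∀ {i j : Fin m} {v : V}, i ≠ j → v ∈ X j → v ∉ X i := by
    rintro i j _ hij ⟨v, hv, rfl⟩ ⟨u, hu, huv⟩
    rw [Subtype.coe_injective huv] at hu
    exact Set.disjoint_left.mp (hQ.2.2.1 i j hij) hu hv
  let φ : Subgroup.center (Γ.induce T).ArtinGroup →* Γ.ArtinGroup :=
    (Γ.inclHom T).comp (Subgroup.subtype _)
  have hφσ : ∀ z, ∀ t ∈ T, Commute (φ z) (Γ.σ t) := by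
    intro z t ht
    have h1 : Commute (z : (Γ.induce T).ArtinGroup) ((Γ.induce T).σ ⟨t, ht⟩) :=
      (Subgroup.mem_center_iff.mp z.2 _).symm
    have h2 := h1.map (Γ.inclHom T)
    rwa [inclHom_σ] at h2
  have hcenter : ∀ a ∈ (Γ.inclHom T).range, (∀ t ∈ T, Commute a (Γ.σ t)) → ∃ z, φ z = a := by
    rintro _ ⟨a, rfl⟩ ha
    refine ⟨⟨a, Subgroup.mem_center_iff.mpr fun b => ?_⟩, rfl⟩
    refine (commute_of_commute_σ (fun v => ?_) b).symm
    refine Γ.inclHom_injective T ?_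
    rw [map_mul, map_mul, inclHom_σ]
    exact ha v v.2
  have hC : ∀ j : J, ∃ z, φ z = Γ.fullTwist (X j) := by
    intro j
    refine hcenter _ ?_ fun t ht => commute_fullTwist_σ (hX j) ?_
    · obtain ⟨a, ha⟩ := (fullTwist_spec (hX j)).1
      have hXT : X j ⊆ T := by
        rintro _ ⟨t, -, rfl⟩
        exact t.2
      exact ⟨_, (Γ.inclHom_induceHom T hXT a).trans ha⟩
    · rintro htX _ ⟨u, hu, rfl⟩
      exact hQ.eq_two_of_not_mem (v := ⟨t, ht⟩) hu fun h => htX ⟨_, h, rfl⟩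
  choose C hC using hC
  let f : T → Additive (Subgroup.center (Γ.induce T).ArtinGroup) →+ ℤ := fun t =>
    crossHom φ (Γ.coxSystem.simple t) fun z => commute_simple_of_commute_σ (hφσ z t t.2)
  have hf1 : ∀ (j : J) (t), t ∈ Q j → f t (.ofMul (C j)) ≠ 0 := by
    intro j t ht
    have := (fullTwist_spec (hX j)).2.2.2.1 t ⟨t, ht, rfl⟩
    rwa [← hC] at this
  have hf2 : ∀ (i j : J) (t), t ∈ Q j → i ≠ j → f t (.ofMul (C i)) = 0 := by
    intro i j t ht hij
    have := crossNumber_fullTwist_simple_eq_zero (hX i)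
      (hXX (Subtype.coe_injective.ne hij) ⟨t, ht, rfl⟩)
    rwa [← hC] at this
  choose t ht using hQ.1
  have hCli : LinearIndependent ℤ fun j : J => Additive.ofMul (C j) :=
    linearIndependent_of_apply_eq_zero (f := fun j : J => f (t j)) (fun j : J => hf1 j _ (ht j))
      fun i j hij => hf2 i j _ (ht j) hij
  intro n P hP
  have hι : ∀ z : Subgroup.center Γ.ArtinGroup, ∃ y, φ y = z := fun z =>
    hcenter z (Γ.center_le_range_inclHom_conePoints z.2)
      fun t _ => (Subgroup.mem_center_iff.mp z.2 _).symm
  choose ι hι using hι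
  have hφinj : Function.Injective φ := (Γ.inclHom_injective T).comp Subtype.coe_injective
  let ι' : Additive (Subgroup.center Γ.ArtinGroup) →+
      Additive (Subgroup.center (Γ.induce T).ArtinGroup) :=
    AddMonoidHom.mk' (fun z => .ofMul (ι z.toMul)) fun a b => hφinj <|
      (hι _).trans <| ((φ.map_mul _ _).trans (congrArg₂ _ (hι _) (hι _))).symm
  have hιinj : Function.Injective ι' := fun a b hab =>
    Subtype.ext ((hι a).symm.trans ((congrArg φ hab).trans (hι b)))
  set K := {i : Fin n // (Γ.induce (P i)).Spherical}
  let D : K → Subgroup.center Γ.ArtinGroup := fun k => ⟨Γ.fullTwist (P k),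
    Subgroup.mem_center_iff.mpr fun b => (commute_of_commute_σ (fun v => commute_fullTwist_σ k.2
      fun hv u hu => hP.eq_two_of_not_mem hu hv) b).symm⟩
  have hDli : LinearIndependent ℤ fun k : K => Additive.ofMul (D k) := by
    choose s hs using hP.1
    refine linearIndependent_of_apply_eq_zero
      (f := fun k : K => crossHom (Subgroup.subtype _) (Γ.coxSystem.simple (s k)) fun z =>
        commute_simple_of_commute_σ (Subgroup.mem_center_iff.mp z.2 _).symm)
      (fun k => (fullTwist_spec k.2).2.2.2.1 _ (hs k)) fun i k hik => ?_
    exact crossNumber_fullTwist_simple_eq_zero i.2 (Set.disjoint_right.mp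
      (hP.2.2.1 i k (Subtype.coe_injective.ne hik)) (hs k))
  have hfree := Module.Free.of_equiv e'.toIntLinearEquiv.symm
  have hfinite := Module.Finite.equiv e'.toIntLinearEquiv.symm
  obtain ⟨e''⟩ := nonempty_addEquiv_of_span hιinj hDli fun z => by
    obtain ⟨N, hN, hz⟩ := exists_smul_mem_span_of_card_eq hCli e' (ι' z)
    refine ⟨N, hN, ?_⟩
    suffices hmem : ι'.toIntLinearMap (N • z) ∈ (Submodule.span ℤ
        (Set.range fun k => Additive.ofMul (D k))).map ι'.toIntLinearMap by
      obtain ⟨y, hy, hyz⟩ := hmem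
      exact hιinj hyz ▸ hy
    rw [← map_zsmul] at hz
    change ι' (N • z) ∈ _
    generalize N • z = z at hz ⊢
    have huncross : ∀ x, (∀ j : J, x ∉ Γ.coxSystem.parabolic (X j)) →
        φ (ι' z).toMul ∈ uncrossing x := by
      intro x hx
      have hle : Submodule.span ℤ (Set.range fun j => Additive.ofMul (C j)) ≤
          AddSubgroup.toIntSubmodule (Subgroup.toAddSubgroup ((uncrossing x).comap φ)) := by
        rw [Submodule.span_le]
        rintro _ ⟨j, rfl⟩
        change φ (C j) ∈ uncrossing x
        rw [hC]
        refine ⟨?_, (fullTwist_spec (hX j)).2.2.2.2 x (hx j)⟩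
        rw [(fullTwist_spec (hX j)).2.1]
        exact Commute.one_left x
      exact hle hz
    have := Fintype.ofFinite J
    obtain ⟨a, ha⟩ := (Submodule.mem_span_range_iff_exists_fun ℤ).mp hz
    rw [← ha]
    refine Submodule.sum_mem _ fun j _ => ?_
    by_cases hj : ∀ u ∈ X j, ∀ v ∉ X j, Γ.m u v = 2
    · obtain ⟨k, hk⟩ := hQ.exists_eq_image hP j hj
      have hk' : (Γ.induce (P k)).Spherical := hk ▸ hX j
      refine Submodule.smul_mem _ _ ⟨.ofMul (D ⟨k, hk'⟩), Submodule.subset_span ⟨_, rfl⟩, ?_⟩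
      refine hφinj ((hι _).trans ?_)
      exact (congrArg Γ.fullTwist hk).trans (hC j).symm
    · push Not at hj
      obtain ⟨_, ⟨q, hq, rfl⟩, s, hs, hqs⟩ := hj
      have hsT : s ∉ T := fun hsT =>
        hqs (hQ.eq_two_of_not_mem (v := ⟨s, hsT⟩) hq fun h => hs ⟨_, h, rfl⟩)
      have hsq : s ≠ q := fun h => hsT (h ▸ q.2)
      have hzero : f q (ι' z) = 0 := by
        have h1 := huncross (Γ.coxSystem.simple s * Γ.coxSystem.simple q * Γ.coxSystem.simple s)
          fun i => Γ.coxSystem.simple_conj_not_mem_parabolic (fun ⟨r, _, hr⟩ => hsT (hr ▸ r.2)) hsq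
            fun h => hqs (by rw [Γ.symm]; exact (coxMatrix_eq_iff hsq two_ne_zero).mp h)
        have hcomm : Commute (φ (ι' z).toMul) (Γ.σ s) := by
          have : φ (ι' z).toMul = z.toMul := hι _
          rw [this]
          exact (Subgroup.mem_center_iff.mp z.toMul.2 _).symm
        have h2 := crossNumber_conj hcomm (commute_simple_of_commute_σ (hφσ (ι' z).toMul q q.2))
        rw [artinToCoxeter_σ, inv_simple, h1.2] at h2
        exact h2.symm
      have haj : a j = 0 := by
        rw [← ha, map_sum, Finset.sum_eq_single j (fun i _ hij => by
          rw [map_zsmul, hf2 i j q hq hij, smul_zero]) (by simp), map_zsmul, smul_eq_mul] at hzero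
        exact (mul_eq_zero.mp hzero).resolve_right (hf1 j q hq)
      rw [haj, zero_smul]
      exact zero_mem _
  exact ⟨MulEquiv.toAdditiveLeft.symm e''⟩
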